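/- Let c > -1 be a constant and let f : [1, ∞) → ℝ be a differentiable function satisfying f(x) = O(x^c) and f'(x) = O(x^{c-1}) for x ≥ 1. Then for every constant A > 0 there is a constant such that for all 3/2 < y ≤ x, Σ_{y < p ≤ x, p prime} f(p) = ∫_y^x f(t)/log t dt + O(x^{c+1}/(log x)^A). -/

import Mathlib

open Filter Finset

/-- The entire function `(s - 1) ζ(s)`. -/
noncomputable def zetaMulSub : ℂ → ℂ :=
  Function.update (fun s : ℂ ↦ (s - 1) * riemannZeta s) 1 1

theorem zetaMulSub_one : zetaMulSub 1 = 1 := Function.update_self ..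

theorem zetaMulSub_of_ne {s : ℂ} (hs : s ≠ 1) : zetaMulSub s = (s - 1) * riemannZeta s :=
  Function.update_of_ne hs ..

theorem differentiable_zetaMulSub : Differentiable ℂ zetaMulSub := by
  have key : ∀ s : ℂ, s ≠ 1 → DifferentiableAt ℂ zetaMulSub s := fun s hs ↦ by
    have h : DifferentiableAt ℂ (fun s : ℂ ↦ (s - 1) * riemannZeta s) s :=
      (by fun_prop : DifferentiableAt ℂ (fun s : ℂ ↦ s - 1) s).mul (differentiableAt_riemannZeta hs)
    refine h.congr_of_eventuallyEq ?_
    filter_upwards [eventually_ne_nhds hs] with t ht using zetaMulSub_of_ne ht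
  intro s
  rcases ne_or_eq s 1 with hs | rfl
  · exact key s hs
  refine (Complex.analyticAt_of_differentiable_on_punctured_nhds_of_continuousAt
    ?_ ?_).differentiableAt
  · filter_upwards [self_mem_nhdsWithin] with t ht using key t ht
  · simpa only [zetaMulSub, continuousAt_update_same] using riemannZeta_residue_one

/-- The `n`-th Euler-Maclaurin correction term of `(s - 1) ζ(s)`. -/
noncomputable def zetaCorrection (n : ℕ) (s : ℂ) : ℂ :=
  (s - 1) * (n : ℂ) ^ (-s) + ((n + 1 : ℕ) : ℂ) ^ (1 - s) - (n : ℂ) ^ (1 - s)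

theorem norm_natCast_cpow_sub_le {n : ℕ} (hn : 0 < n) {s : ℂ} (hs : 0 < s.re) {u : ℝ}
    (hu : u ∈ Set.Icc (n : ℝ) (n + 1)) :
    ‖(u : ℂ) ^ (-s) - (n : ℂ) ^ (-s)‖ ≤ ‖s‖ * (n : ℝ) ^ (-s.re - 1) := by
  have hn' : (0 : ℝ) < n := by exact_mod_cast hn
  have hs0 : -s ≠ 0 := by
    intro h
    rw [neg_eq_zero] at h
    simp [h] at hs
  have := norm_image_sub_le_of_norm_deriv_le_segment' (a := (n : ℝ)) (b := n + 1)
    (f := fun y : ℝ ↦ (y : ℂ) ^ (-s)) (f' := fun y ↦ -s * (y : ℂ) ^ (-s - 1))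
    (C := ‖s‖ * (n : ℝ) ^ (-s.re - 1))
    (fun x hx ↦ (hasDerivAt_ofReal_cpow_const (by linarith [hx.1]) hs0).hasDerivWithinAt)
    (fun x hx ↦ by
      rw [norm_mul, norm_neg, Complex.norm_cpow_eq_rpow_re_of_pos (by linarith [hx.1])]
      gcongr ?_ * ?_
      simp only [Complex.sub_re, Complex.neg_re, Complex.one_re]
      exact Real.rpow_le_rpow_of_nonpos hn' hx.1 (by linarith)) u hu
  simp only [Complex.ofReal_natCast] at this
  refine this.trans ?_
  have h1 : u - n ≤ 1 := by linarith [hu.2]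
  exact mul_le_of_le_one_right (by positivity) h1

theorem norm_zetaCorrection_le {n : ℕ} (hn : 0 < n) {s : ℂ} (hs : 0 < s.re) :
    ‖zetaCorrection n s‖ ≤ ‖s - 1‖ * ‖s‖ * (n : ℝ) ^ (-s.re - 1) := by
  have hn' : (0 : ℝ) < n := by exact_mod_cast hn
  rcases eq_or_ne s 1 with rfl | h1
  · simp [zetaCorrection]
  have h1' : 1 - s ≠ 0 := sub_ne_zero.mpr h1.symm
  have := norm_image_sub_le_of_norm_deriv_le_segment' (a := (n : ℝ)) (b := n + 1)
    (f := fun y : ℝ ↦ (s - 1) * (n : ℂ) ^ (-s) * (y - n : ℂ) + (y : ℂ) ^ (1 - s))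
    (f' := fun y ↦ (s - 1) * (n : ℂ) ^ (-s) * 1 + (1 - s) * (y : ℂ) ^ (1 - s - 1))
    (C := ‖s - 1‖ * ‖s‖ * (n : ℝ) ^ (-s.re - 1))
    (fun x hx ↦ by
      refine HasDerivAt.hasDerivWithinAt (HasDerivAt.add ?_
        (hasDerivAt_ofReal_cpow_const (by linarith [hx.1]) h1'))
      refine HasDerivAt.const_mul _ ?_
      exact (Complex.ofRealCLM.hasDerivAt (x := x)).sub_const _)
    (fun x hx ↦ by
      have e : (s - 1) * (n : ℂ) ^ (-s) * 1 + (1 - s) * (x : ℂ) ^ (1 - s - 1)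
          = (1 - s) * ((x : ℂ) ^ (-s) - (n : ℂ) ^ (-s)) := by
        rw [show 1 - s - 1 = -s by ring]; ring
      rw [e, norm_mul, norm_sub_rev 1 s, mul_assoc]
      gcongr
      exact norm_natCast_cpow_sub_le hn hs ⟨hx.1, hx.2.le⟩) (n + 1) ⟨by linarith, le_rfl⟩
  refine le_trans (le_of_eq ?_) (this.trans (le_of_eq ?_))
  · congr 1
    simp [zetaCorrection]
  · ring

theorem differentiable_zetaCorrection {n : ℕ} (hn : 0 < n) :
    Differentiable ℂ (zetaCorrection n) := by
  have h1 : (n : ℂ) ≠ 0 := by exact_mod_cast hn.ne'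
  have h2 : ((n + 1 : ℕ) : ℂ) ≠ 0 := by exact_mod_cast (Nat.succ_ne_zero n)
  unfold zetaCorrection
  have a1 : Differentiable ℂ (fun s : ℂ ↦ (n : ℂ) ^ (-s)) :=
    (differentiable_id.neg).const_cpow (Or.inl h1)
  have a2 : Differentiable ℂ (fun s : ℂ ↦ (n : ℂ) ^ (1 - s)) :=
    (differentiable_id.const_sub 1).const_cpow (Or.inl h1)
  have a3 : Differentiable ℂ (fun s : ℂ ↦ ((n + 1 : ℕ) : ℂ) ^ (1 - s)) :=
    (differentiable_id.const_sub 1).const_cpow (Or.inl h2)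
  exact (((differentiable_id.sub_const 1).mul a1).add a3).sub a2

theorem summable_nat_add_rpow (N : ℕ) {p : ℝ} (hp : p < -1) :
    Summable fun k : ℕ ↦ ((N + k : ℕ) : ℝ) ^ p := by
  have := (summable_nat_add_iff (f := fun n : ℕ ↦ (n : ℝ) ^ p) N).2 (Real.summable_nat_rpow.2 hp)
  simpa only [add_comm] using this

theorem zetaMulSub_eq_of_one_lt_re {N : ℕ} (hN : 0 < N) {s : ℂ} (hs : 1 < s.re) :
    zetaMulSub s = (s - 1) * ∑ n ∈ range N, (if n = 0 then 0 else (n : ℂ) ^ (-s))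
      + (N : ℂ) ^ (1 - s) + ∑' k, zetaCorrection (N + k) s := by
  have hs1 : s ≠ 1 := by rintro rfl; simp at hs
  set a : ℕ → ℂ := fun n ↦ if n = 0 then 0 else (n : ℂ) ^ (-s) with ha
  have ha' : a = LSeries.term 1 s := by
    ext n
    simp [ha, LSeries.term, Complex.cpow_neg]
  have hsum : HasSum a (riemannZeta s) := by
    rw [ha', ← LSeries_one_eq_riemannZeta hs]
    exact (LSeriesSummable_one_iff.2 hs).LSeriesHasSum
  have htail : HasSum (fun k ↦ a (k + N)) (riemannZeta s - ∑ n ∈ range N, a n) :=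
    (hasSum_nat_add_iff' N).2 hsum
  have hcorr : Summable fun k ↦ zetaCorrection (N + k) s := by
    refine Summable.of_norm_bounded
      ((summable_nat_add_rpow N (p := -s.re - 1) (by linarith)).mul_left (‖s - 1‖ * ‖s‖)) ?_
    intro k
    exact norm_zetaCorrection_le (by omega) (by linarith)
  have htel : HasSum (fun k ↦ zetaCorrection (N + k) s - (s - 1) * a (k + N))
      (-(N : ℂ) ^ (1 - s)) := by
    rw [(hcorr.sub (htail.summable.mul_left (s - 1))).hasSum_iff_tendsto_nat]
    have e : ∀ m, ∑ k ∈ range m, (zetaCorrection (N + k) s - (s - 1) * a (k + N))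
        = ((N + m : ℕ) : ℂ) ^ (1 - s) - (N : ℂ) ^ (1 - s) := by
      intro m
      have h0 := Finset.sum_range_sub (fun k ↦ ((N + k : ℕ) : ℂ) ^ (1 - s)) m
      simp only [Nat.add_zero] at h0
      rw [← h0]
      refine Finset.sum_congr rfl fun k _ ↦ ?_
      have : k + N ≠ 0 := by omega
      rw [add_comm] at this
      simp only [zetaCorrection, ha, add_comm k N, this, if_false, ← add_assoc]
      ring
    simp_rw [e]
    rw [← zero_sub]
    refine Tendsto.sub_const ?_ _
    rw [tendsto_zero_iff_norm_tendsto_zero]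
    have e2 : ∀ m : ℕ, ‖((N + m : ℕ) : ℂ) ^ (1 - s)‖ = ((N + m : ℕ) : ℝ) ^ (-(s.re - 1)) := by
      intro m
      rw [Complex.norm_natCast_cpow_of_pos (by omega)]
      simp
    simp_rw [e2]
    refine (tendsto_rpow_neg_atTop (by linarith)).comp (tendsto_natCast_atTop_atTop.comp ?_)
    exact tendsto_atTop_mono (fun m ↦ Nat.le_add_left m N) tendsto_id
  have := (hcorr.hasSum.sub (htail.mul_left (s - 1))).unique htel
  rw [zetaMulSub_of_ne hs1]
  linear_combination -this

theorem zetaMulSub_eq {N : ℕ} (hN : 0 < N) {s : ℂ} (hs : 1 / 2 < s.re) :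
    zetaMulSub s = (s - 1) * ∑ n ∈ range N, (if n = 0 then 0 else (n : ℂ) ^ (-s))
      + (N : ℂ) ^ (1 - s) + ∑' k, zetaCorrection (N + k) s := by
  have hN' : (N : ℂ) ≠ 0 := by exact_mod_cast hN.ne'
  set U : Set ℂ := {s : ℂ | 1 / 2 < s.re} ∩ Metric.ball 0 (‖s‖ + 3) with hU
  have hUo : IsOpen U := (isOpen_lt continuous_const Complex.continuous_re).inter Metric.isOpen_ball
  have hUc : IsPreconnected U :=
    ((convex_halfSpace_re_gt _).inter (convex_ball _ _)).isPreconnected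
  have hd : DifferentiableOn ℂ (fun s ↦ ∑' k, zetaCorrection (N + k) s) U := by
    refine Complex.differentiableOn_tsum_of_summable_norm
      (u := fun k ↦ (‖s‖ + 4) * (‖s‖ + 3) * ((N + k : ℕ) : ℝ) ^ (-(3 / 2) : ℝ))
      ((summable_nat_add_rpow N (by norm_num)).mul_left _)
      (fun k ↦ (differentiable_zetaCorrection (by omega)).differentiableOn) hUo ?_
    rintro k w ⟨hw1, hw2⟩
    have hw1 : 1 / 2 < w.re := hw1
    have hw2 : ‖w‖ < ‖s‖ + 3 := by simpa using hw2
    refine (norm_zetaCorrection_le (by omega) (by linarith)).trans ?_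
    have h3 : ‖w - 1‖ ≤ ‖s‖ + 4 := (norm_sub_le _ _).trans (by simp; linarith)
    have h4 : ((N + k : ℕ) : ℝ) ^ (-w.re - 1) ≤ ((N + k : ℕ) : ℝ) ^ (-(3 / 2) : ℝ) :=
      Real.rpow_le_rpow_of_exponent_le (by exact_mod_cast (by omega : 1 ≤ N + k)) (by linarith)
    gcongr
  have hrhs : DifferentiableOn ℂ (fun s ↦ (s - 1) * ∑ n ∈ range N,
      (if n = 0 then 0 else (n : ℂ) ^ (-s)) + (N : ℂ) ^ (1 - s)
        + ∑' k, zetaCorrection (N + k) s) U := by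
    refine DifferentiableOn.add (Differentiable.differentiableOn ?_) hd
    refine Differentiable.add ?_ ((differentiable_id.const_sub 1).const_cpow (Or.inl hN'))
    refine (differentiable_id.sub_const 1).mul ?_
    refine Differentiable.fun_sum fun n _ ↦ ?_
    split_ifs with h
    · exact differentiable_const _
    · exact differentiable_id.neg.const_cpow (Or.inl (by exact_mod_cast h))
  have h2 : (2 : ℂ) ∈ U := ⟨by simp; norm_num, by simp; linarith [norm_nonneg s]⟩
  refine (differentiable_zetaMulSub.differentiableOn.analyticOnNhd hUo).eqOn_of_preconnected_of_eventuallyEq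
    (hrhs.analyticOnNhd hUo) hUc h2 ?_ ⟨hs, by simp⟩
  have : {s : ℂ | 1 < s.re} ∈ nhds (2 : ℂ) :=
    (isOpen_lt continuous_const Complex.continuous_re).mem_nhds (by simp)
  filter_upwards [this] with t ht using zetaMulSub_eq_of_one_lt_re hN ht

theorem sum_range_inv_le {N : ℕ} (hN : 0 < N) :
    ∑ n ∈ range N, (n : ℝ)⁻¹ ≤ 1 + Real.log N := by
  obtain ⟨M, rfl⟩ : ∃ M, N = M + 1 := ⟨N - 1, by omega⟩
  have h := harmonic_le_one_add_log M
  rw [Finset.sum_range_succ']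
  simp only [harmonic, Rat.cast_sum, Rat.cast_inv, Rat.cast_natCast] at h
  simp only [Nat.cast_zero, inv_zero, add_zero]
  refine h.trans ?_
  rcases Nat.eq_zero_or_pos M with rfl | hM
  · simp
  · have : Real.log M ≤ Real.log (M + 1 : ℕ) :=
      Real.log_le_log (by exact_mod_cast hM) (by push_cast; linarith)
    linarith

theorem one_le_log_of_four_le {X : ℝ} (hX : 4 ≤ X) : 1 ≤ Real.log X := by
  rw [Real.le_log_iff_exp_le (by linarith)]
  linarith [Real.exp_one_lt_d9]

theorem exists_norm_zeta_le : ∃ C : ℝ, 0 < C ∧ ∀ X : ℝ, 4 ≤ X → ∀ s : ℂ, 1 / 2 ≤ |s.im| →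
    |s.im| + 3 ≤ X → 1 - 1 / (2 * Real.log X) ≤ s.re → s.re ≤ 3 →
    ‖riemannZeta s‖ ≤ C * Real.log X := by
  set S : ℝ := ∑' k : ℕ, ((1 + k : ℕ) : ℝ) ^ (-(5 / 4) : ℝ) with hS
  have hsumS := summable_nat_add_rpow 1 (p := -(5 / 4)) (by norm_num)
  have hS0 : 0 ≤ S := tsum_nonneg fun k ↦ by positivity
  refine ⟨8 * Real.exp (5 / 2) + S, by positivity, fun X hX s him hsX hre hre3 ↦ ?_⟩
  have hL := one_le_log_of_four_le hX
  set Λ := Real.log X with hΛ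
  have hΛ2 : 1 < Λ := by
    rw [hΛ, Real.lt_log_iff_exp_lt (by linarith)]
    linarith [Real.exp_one_lt_d9]
  have hre1 : 1 / 2 < s.re := by
    have : 1 / (2 * Λ) < 1 / 2 := by
      apply one_div_lt_one_div_of_lt <;> linarith
    linarith
  set N := ⌈X ^ 4⌉₊ with hN
  have hX4 : 1 ≤ X ^ 4 := one_le_pow₀ (by linarith)
  have hN1 : X ^ 4 ≤ N := Nat.le_ceil _
  have hN2 : (N : ℝ) ≤ X ^ 5 := by
    have := (Nat.ceil_lt_add_one (by linarith : 0 ≤ X ^ 4)).le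
    calc (N : ℝ) ≤ X ^ 4 + 1 := this
      _ ≤ X ^ 4 * 4 := by linarith
      _ ≤ X ^ 4 * X := by gcongr
      _ = X ^ 5 := by ring
  have hN0 : 0 < N := by
    have : (0 : ℝ) < N := by linarith
    exact_mod_cast this
  have hlogN : ∀ n : ℕ, 0 < n → n ≤ N → Real.log n ≤ 5 * Λ := by
    intro n hn hnN
    have : (n : ℝ) ≤ X ^ 5 := le_trans (by exact_mod_cast hnN) hN2
    calc Real.log n ≤ Real.log (X ^ 5) := Real.log_le_log (by exact_mod_cast hn) this
      _ = 5 * Λ := by rw [Real.log_pow, ← hΛ]; norm_num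
  have hpow : ∀ n : ℕ, 0 < n → n ≤ N → (n : ℝ) ^ (1 - s.re) ≤ Real.exp (5 / 2) := by
    intro n hn hnN
    have hn' : (0 : ℝ) < n := by exact_mod_cast hn
    rw [Real.rpow_def_of_pos hn']
    apply Real.exp_le_exp.2
    have h0 : 0 ≤ Real.log n := Real.log_natCast_nonneg n
    calc Real.log n * (1 - s.re) ≤ Real.log n * (1 / (2 * Λ)) := by
          gcongr; linarith
      _ ≤ 5 * Λ * (1 / (2 * Λ)) := by gcongr; exact hlogN n hn hnN
      _ = 5 / 2 := by field_simp
  have hs1 : 1 / 2 ≤ ‖s - 1‖ := by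
    refine him.trans ?_
    simpa using Complex.abs_im_le_norm (s - 1)
  have hs1' : s ≠ 1 := by rintro rfl; simp at hs1; linarith
  have hsX' : ‖s‖ ≤ X := by
    refine (Complex.norm_le_abs_re_add_abs_im s).trans ?_
    rw [abs_of_pos (by linarith)]; linarith
  have hA : ‖∑ n ∈ range N, (if n = 0 then 0 else (n : ℂ) ^ (-s))‖
      ≤ Real.exp (5 / 2) * (1 + 5 * Λ) := by
    calc _ ≤ ∑ n ∈ range N, Real.exp (5 / 2) * (n : ℝ)⁻¹ := by
          refine norm_sum_le_of_le _ fun n hn ↦ ?_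
          split_ifs with h
          · simp [h]
          · have hn0 : 0 < n := Nat.pos_of_ne_zero h
            have hn' : (0 : ℝ) < n := by exact_mod_cast hn0
            rw [Complex.norm_natCast_cpow_of_pos hn0, Complex.neg_re,
              show -s.re = (1 - s.re) + (-1) by ring, Real.rpow_add hn', Real.rpow_neg_one]
            gcongr
            exact hpow n hn0 (mem_range.1 hn).le
      _ ≤ _ := by
          rw [← Finset.mul_sum]
          gcongr
          refine (sum_range_inv_le hN0).trans ?_
          linarith [hlogN N hN0 le_rfl]
  have hB : ‖(N : ℂ) ^ (1 - s)‖ ≤ Real.exp (5 / 2) := by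
    rw [Complex.norm_natCast_cpow_of_pos hN0]
    exact hpow N hN0 le_rfl
  have hC : ‖∑' k, zetaCorrection (N + k) s‖ ≤ ‖s - 1‖ * S := by
    refine tsum_of_norm_bounded (hsumS.hasSum.mul_left ‖s - 1‖) fun k ↦ ?_
    refine (norm_zetaCorrection_le (by omega) (by linarith)).trans ?_
    rw [mul_assoc]
    refine mul_le_mul_of_nonneg_left ?_ (norm_nonneg _)
    have hk : (0 : ℝ) < (N + k : ℕ) := by exact_mod_cast (by omega)
    have h1 : ((N + k : ℕ) : ℝ) ^ (-s.re - 1) ≤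
        ((N + k : ℕ) : ℝ) ^ (-(1 / 4) : ℝ) * ((N + k : ℕ) : ℝ) ^ (-(5 / 4) : ℝ) := by
      rw [← Real.rpow_add hk]
      refine Real.rpow_le_rpow_of_exponent_le (by exact_mod_cast (by omega)) (by linarith)
    have h2 : ((N + k : ℕ) : ℝ) ^ (-(1 / 4) : ℝ) ≤ X⁻¹ := by
      calc ((N + k : ℕ) : ℝ) ^ (-(1 / 4) : ℝ) ≤ (X ^ 4) ^ (-(1 / 4) : ℝ) := by
            refine Real.rpow_le_rpow_of_nonpos (by positivity) ?_ (by norm_num)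
            push_cast
            linarith [(Nat.cast_nonneg k : (0 : ℝ) ≤ k)]
        _ = X⁻¹ := by
            rw [← Real.rpow_natCast, ← Real.rpow_mul (by linarith), ← Real.rpow_neg_one]
            norm_num
    have h3 : ((N + k : ℕ) : ℝ) ^ (-(5 / 4) : ℝ) ≤ ((1 + k : ℕ) : ℝ) ^ (-(5 / 4) : ℝ) :=
      Real.rpow_le_rpow_of_nonpos (by positivity) (by exact_mod_cast (by omega)) (by norm_num)
    calc ‖s‖ * ((N + k : ℕ) : ℝ) ^ (-s.re - 1)
        ≤ X * (X⁻¹ * ((1 + k : ℕ) : ℝ) ^ (-(5 / 4) : ℝ)) := by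
          gcongr
          exact h1.trans (by gcongr)
      _ = ((1 + k : ℕ) : ℝ) ^ (-(5 / 4) : ℝ) := by field_simp
  have key := zetaMulSub_eq hN0 hre1
  rw [zetaMulSub_of_ne hs1'] at key
  have hfin : ‖s - 1‖ * ‖riemannZeta s‖ ≤
      ‖s - 1‖ * (Real.exp (5 / 2) * (1 + 5 * Λ)) + Real.exp (5 / 2) + ‖s - 1‖ * S := by
    rw [← norm_mul, key]
    refine (norm_add₃_le).trans ?_
    rw [norm_mul]
    gcongr
  have hE := Real.exp_pos (5 / 2)
  have : ‖s - 1‖ * ‖riemannZeta s‖ ≤ ‖s - 1‖ * ((8 * Real.exp (5 / 2) + S) * Λ) := by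
    refine hfin.trans ?_
    have e1 : Real.exp (5 / 2) ≤ ‖s - 1‖ * (2 * Real.exp (5 / 2)) := by nlinarith
    calc _ ≤ ‖s - 1‖ * (Real.exp (5 / 2) * (1 + 5 * Λ)) + ‖s - 1‖ * (2 * Real.exp (5 / 2))
          + ‖s - 1‖ * S := by gcongr
      _ = ‖s - 1‖ * (Real.exp (5 / 2) * (3 + 5 * Λ) + S) := by ring
      _ ≤ _ := by
        gcongr
        nlinarith
  exact le_of_mul_le_mul_left this (by linarith)

theorem exists_norm_deriv_zeta_le : ∃ C : ℝ, 0 < C ∧ ∀ X : ℝ, 5 ≤ X → ∀ s : ℂ, 1 ≤ |s.im| →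
    |s.im| + 4 ≤ X → 1 - 1 / (4 * Real.log X) ≤ s.re → s.re ≤ 2 →
    ‖deriv riemannZeta s‖ ≤ C * Real.log X ^ 2 := by
  obtain ⟨C, hC, h⟩ := exists_norm_zeta_le
  refine ⟨4 * C, by positivity, fun X hX s him hsX hre hre2 ↦ ?_⟩
  have hL := one_le_log_of_four_le (by linarith : 4 ≤ X)
  set Λ := Real.log X with hΛ
  have hr : 0 < 1 / (4 * Λ) := by positivity
  have hr4 : 1 / (4 * Λ) ≤ 1 / 4 := by
    apply one_div_le_one_div_of_le <;> linarith
  have hmem : ∀ z ∈ Metric.closedBall s (1 / (4 * Λ)),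
      |(z - s).re| ≤ 1 / (4 * Λ) ∧ |(z - s).im| ≤ 1 / (4 * Λ) := by
    intro z hz
    rw [mem_closedBall_iff_norm] at hz
    exact ⟨(Complex.abs_re_le_norm _).trans hz, (Complex.abs_im_le_norm _).trans hz⟩
  have him2 : ∀ z ∈ Metric.closedBall s (1 / (4 * Λ)), 1 / 2 ≤ |z.im| ∧ |z.im| + 3 ≤ X := by
    intro z hz
    have h1 := (hmem z hz).2
    rw [Complex.sub_im] at h1
    have h2 := abs_abs_sub_abs_le z.im s.im
    have h3 := abs_le.1 (h2.trans (h1.trans hr4))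
    constructor <;> linarith [h3.1, h3.2]
  have hdiff : DiffContOnCl ℂ riemannZeta (Metric.ball s (1 / (4 * Λ))) := by
    refine DifferentiableOn.diffContOnCl fun z hz ↦ ?_
    have hz' := Metric.closure_ball_subset_closedBall hz
    refine (differentiableAt_riemannZeta ?_).differentiableWithinAt
    rintro rfl
    have := (him2 _ hz').1
    simp at this
    linarith
  refine (Complex.norm_deriv_le_of_forall_mem_sphere_norm_le hr hdiff (C := C * Λ)
    fun z hz ↦ ?_).trans (le_of_eq (by field_simp))
  have hz' := Metric.sphere_subset_closedBall hz
  have h1 := abs_le.1 (hmem z hz').1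
  rw [Complex.sub_re] at h1
  have e : 1 / (2 * Λ) = 1 / (4 * Λ) + 1 / (4 * Λ) := by field_simp; norm_num
  refine h X (by linarith) z (him2 z hz').1 (him2 z hz').2 ?_ ?_
  · rw [← hΛ, e]; linarith [h1.1]
  · linarith [h1.2]

theorem one_le_norm_zeta_product {x : ℝ} (hx : 0 < x) (y : ℝ) :
    1 ≤ ‖riemannZeta (1 + x)‖ ^ 3 * ‖riemannZeta (1 + x + Complex.I * y)‖ ^ 4 *
      ‖riemannZeta (1 + x + 2 * Complex.I * y)‖ := by
  have := DirichletCharacter.norm_LFunction_product_ge_one (1 : DirichletCharacter ℂ 1) hx y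
  simpa only [DirichletCharacter.LFunctionTrivChar, DirichletCharacter.LFunction_modOne_eq,
    norm_mul, norm_pow, ge_iff_le] using this

theorem exists_norm_zeta_one_add_le : ∃ C : ℝ, 0 < C ∧ ∀ x : ℝ, 0 < x → x ≤ 1 →
    ‖riemannZeta (1 + x)‖ ≤ C / x := by
  have hc : ContinuousOn (fun x : ℝ ↦ zetaMulSub (1 + x)) (Set.Icc 0 1) :=
    (differentiable_zetaMulSub.continuous.comp (by fun_prop)).continuousOn
  obtain ⟨C, hC⟩ := isCompact_Icc.exists_bound_of_continuousOn hc
  refine ⟨max C 1, by positivity, fun x hx hx1 ↦ ?_⟩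
  have h := hC x ⟨hx.le, hx1⟩
  have hx0 : (x : ℂ) ≠ 0 := by exact_mod_cast hx.ne'
  rw [zetaMulSub_of_ne (by simpa using hx0), norm_mul] at h
  simp only [add_sub_cancel_left, Complex.norm_real, Real.norm_eq_abs, abs_of_pos hx] at h
  rw [le_div_iff₀ hx, mul_comm]
  exact h.trans (le_max_left _ _)

theorem exists_zeta_zero_free : ∃ a B : ℝ, 0 < a ∧ a ≤ 1 / 4 ∧ 0 < B ∧ ∀ X : ℝ, 6 ≤ X →
    ∀ s : ℂ, 1 ≤ |s.im| → 2 * |s.im| + 4 ≤ X → 1 - a / Real.log X ^ 9 ≤ s.re → s.re ≤ 2 →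
    riemannZeta s ≠ 0 ∧ ‖riemannZeta s‖ ≤ B * Real.log X ^ 9 ∧
      ‖deriv riemannZeta s / riemannZeta s‖ ≤ B * Real.log X ^ 9 := by
  obtain ⟨C₀, hC₀, h₀⟩ := exists_norm_zeta_one_add_le
  obtain ⟨C₁, hC₁, h₁⟩ := exists_norm_zeta_le
  obtain ⟨C₂, hC₂, h₂⟩ := exists_norm_deriv_zeta_le
  set d : ℝ := max 1 (C₀ ^ 3 * C₁) with hd
  have hd1 : 1 ≤ d := le_max_left _ _
  have hdC : C₀ ^ 3 * C₁ ≤ d ^ 4 := (le_max_right _ _).trans (le_self_pow₀ hd1 (by norm_num))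
  set b : ℝ := 1 / (4 * (C₂ + 1) * d) with hb
  have hb0 : 0 < b := by positivity
  have hb4 : b ≤ 1 / 4 := by
    apply one_div_le_one_div_of_le (by norm_num)
    nlinarith
  have hbC : 2 * C₂ * b ≤ 1 / (2 * d) := by
    rw [hb, div_eq_mul_inv, div_eq_mul_inv, one_mul, mul_inv, mul_inv, mul_inv]
    have : C₂ * (C₂ + 1)⁻¹ ≤ 1 := by
      rw [← div_eq_mul_inv, div_le_one (by linarith)]; linarith
    calc 2 * C₂ * (4⁻¹ * (C₂ + 1)⁻¹ * d⁻¹) = (C₂ * (C₂ + 1)⁻¹) * (2⁻¹ * d⁻¹) := by ring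
      _ ≤ 1 * (2⁻¹ * d⁻¹) := by gcongr
      _ = 1 * (2⁻¹ * d⁻¹) := rfl
  have hb44 : b ^ 4 ≤ 1 / 4 := (pow_le_of_le_one hb0.le (by linarith) (by norm_num)).trans hb4
  refine ⟨b ^ 4, C₁ + C₂ * (2 * d / b ^ 3), by positivity, hb44, by positivity,
    fun X hX s him hsX hre hre2 ↦ ?_⟩
  have hL := one_le_log_of_four_le (by linarith : 4 ≤ X)
  set Λ := Real.log X with hΛ
  have hδ0 : 0 < b ^ 4 / Λ ^ 9 := by positivity
  have hδ : b ^ 4 / Λ ^ 9 ≤ 1 / (4 * Λ) := by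
    rw [div_le_div_iff₀ (by positivity) (by positivity)]
    have : Λ ≤ Λ ^ 9 := le_self_pow₀ hL (by norm_num)
    nlinarith
  have hδ1 : b ^ 4 / Λ ^ 9 ≤ 1 / 4 := hδ.trans (one_div_le_one_div_of_le (by norm_num) (by linarith))
  -- lower bound to the right of the line `Re s = 1`
  have hright : ∀ x : ℝ, b ^ 4 / Λ ^ 9 ≤ x → x ≤ 1 →
      b ^ 3 / (d * Λ ^ 7) ≤ ‖riemannZeta (1 + x + Complex.I * s.im)‖ := by
    intro x hx hx1
    have hx0 : 0 < x := hδ0.trans_le hx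
    have hp := one_le_norm_zeta_product hx0 s.im
    have hz0 := h₀ x hx0 hx1
    have hz2 : ‖riemannZeta (1 + x + 2 * Complex.I * s.im)‖ ≤ C₁ * Λ := by
      have e : (1 + x + 2 * Complex.I * s.im : ℂ).im = 2 * s.im := by simp
      have e' : (1 + x + 2 * Complex.I * s.im : ℂ).re = 1 + x := by simp
      have e2 : |2 * s.im| = 2 * |s.im| := by rw [abs_mul]; norm_num
      have : 0 < 1 / (2 * Λ) := by positivity
      refine h₁ X (by linarith) _ ?_ ?_ ?_ ?_
      · rw [e, e2]; linarith
      · rw [e, e2]; linarith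
      · rw [e']; linarith
      · rw [e']; linarith
    set w := ‖riemannZeta (1 + x + Complex.I * s.im)‖ with hw
    have hw0 : 0 ≤ w := norm_nonneg _
    have h5 : 1 ≤ (C₀ / x) ^ 3 * w ^ 4 * (C₁ * Λ) := hp.trans (by gcongr)
    have h6 : x ^ 3 ≤ d ^ 4 * w ^ 4 * Λ := by
      have : (C₀ / x) ^ 3 * w ^ 4 * (C₁ * Λ) = C₀ ^ 3 * C₁ * w ^ 4 * Λ / x ^ 3 := by
        field_simp
      rw [this, one_le_div (by positivity)] at h5
      exact h5.trans (by gcongr)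
    have h7 : (b ^ 4 / Λ ^ 9) ^ 3 ≤ d ^ 4 * w ^ 4 * Λ := le_trans (by gcongr) h6
    have h8 : (b ^ 3 / (d * Λ ^ 7)) ^ 4 ≤ w ^ 4 := by
      have e : (b ^ 3 / (d * Λ ^ 7)) ^ 4 = (b ^ 4 / Λ ^ 9) ^ 3 / (d ^ 4 * Λ) := by
        field_simp
      rw [e, div_le_iff₀ (by positivity)]
      linarith
    exact le_of_pow_le_pow_left₀ (by norm_num) hw0 h8
  have hlower : b ^ 3 / (2 * d * Λ ^ 7) ≤ ‖riemannZeta s‖ := by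
    rcases le_total (1 + b ^ 4 / Λ ^ 9) s.re with hcase | hcase
    · have := hright (s.re - 1) (by linarith) (by linarith)
      have e : (1 + ((s.re - 1 : ℝ) : ℂ) + Complex.I * s.im) = s := by
        apply Complex.ext <;> simp
      rw [e] at this
      refine le_trans ?_ this
      gcongr
      linarith
    · have h5 := hright (b ^ 4 / Λ ^ 9) le_rfl (by linarith)
      set s₀ : ℂ := 1 + ((b ^ 4 / Λ ^ 9 : ℝ) : ℂ) + Complex.I * s.im with hs₀
      have hs₀re : s₀.re = 1 + b ^ 4 / Λ ^ 9 := by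
        simp only [hs₀, Complex.add_re, Complex.one_re, Complex.ofReal_re, Complex.mul_re,
          Complex.I_re, Complex.I_im, Complex.ofReal_im]
        ring
      have hs₀im : s₀.im = s.im := by
        simp only [hs₀, Complex.add_im, Complex.one_im, Complex.ofReal_re, Complex.mul_im,
          Complex.I_re, Complex.I_im, Complex.ofReal_im]
        ring
      have hmv := Convex.norm_image_sub_le_of_norm_deriv_le (𝕜 := ℂ) (f := riemannZeta)
        (s := Set.Icc (1 - b ^ 4 / Λ ^ 9) (1 + b ^ 4 / Λ ^ 9) ×ℂ {s.im}) (C := C₂ * Λ ^ 2)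
        (x := s₀) (y := s)
        (fun z hz ↦ differentiableAt_riemannZeta (by
          rintro rfl
          have := hz.2
          simp at this
          rw [← this] at him
          simp at him
          linarith))
        (fun z hz ↦ by
          have hz1 := hz.1
          have hz2 : z.im = s.im := hz.2
          have hz1' : 1 - b ^ 4 / Λ ^ 9 ≤ z.re ∧ z.re ≤ 1 + b ^ 4 / Λ ^ 9 := hz1
          refine h₂ X (by linarith) z (by rwa [hz2]) (by rw [hz2]; linarith) ?_ ?_
          · rw [← hΛ]; linarith
          · linarith)
        (((convex_Icc _ _).linear_preimage Complex.reLm).inter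
          ((convex_singleton _).linear_preimage Complex.imLm))
        ⟨⟨by rw [hs₀re]; linarith, by rw [hs₀re]⟩, hs₀im⟩ ⟨⟨hre, hcase⟩, rfl⟩
      have hdist : ‖s - s₀‖ ≤ 2 * (b ^ 4 / Λ ^ 9) := by
        refine (Complex.norm_le_abs_re_add_abs_im _).trans ?_
        rw [Complex.sub_re, Complex.sub_im, hs₀im, hs₀re, sub_self, abs_zero, add_zero, abs_le]
        constructor <;> linarith
      have h6 : ‖riemannZeta s₀‖ - ‖riemannZeta s‖ ≤ C₂ * Λ ^ 2 * (2 * (b ^ 4 / Λ ^ 9)) := by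
        refine (norm_sub_norm_le _ _).trans ?_
        rw [norm_sub_rev]
        exact hmv.trans (by gcongr)
      have e1 : C₂ * Λ ^ 2 * (2 * (b ^ 4 / Λ ^ 9)) = (2 * C₂ * b) * (b ^ 3 / Λ ^ 7) := by
        field_simp
      have e2 : (2 * C₂ * b) * (b ^ 3 / Λ ^ 7) ≤ 1 / (2 * d) * (b ^ 3 / Λ ^ 7) := by gcongr
      have e3 : b ^ 3 / (d * Λ ^ 7) = 1 / (2 * d) * (b ^ 3 / Λ ^ 7) + b ^ 3 / (2 * d * Λ ^ 7) := by
        field_simp; norm_num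
      linarith
  have hpos : 0 < b ^ 3 / (2 * d * Λ ^ 7) := by positivity
  have hζ0 : 0 < ‖riemannZeta s‖ := hpos.trans_le hlower
  have hpow9 : Λ ≤ Λ ^ 9 := le_self_pow₀ hL (by norm_num)
  have hΛδ : 1 - 1 / (4 * Λ) ≤ s.re := by linarith
  have e4 : 1 / (4 * Λ) ≤ 1 / (2 * Λ) := by gcongr; norm_num
  refine ⟨norm_pos_iff.1 hζ0, ?_, ?_⟩
  · refine (h₁ X (by linarith) s (by linarith) (by linarith) (by rw [← hΛ]; linarith)
      (by linarith)).trans ?_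
    gcongr
    have : 0 ≤ C₂ * (2 * d / b ^ 3) := by positivity
    linarith
  · rw [norm_div]
    calc ‖deriv riemannZeta s‖ / ‖riemannZeta s‖ ≤ (C₂ * Λ ^ 2) / (b ^ 3 / (2 * d * Λ ^ 7)) := by
          gcongr
          exact h₂ X (by linarith) s him (by linarith) hΛδ hre2
      _ = C₂ * (2 * d / b ^ 3) * Λ ^ 9 := by field_simp
      _ ≤ _ := by
        gcongr
        linarith

/-- Minus the logarithmic derivative of `ζ`, minus `ζ`, continued analytically to `s = 1`. -/
noncomputable def vonMangoldtSubOne (s : ℂ) : ℂ :=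
  -(deriv zetaMulSub s / zetaMulSub s) - dslope zetaMulSub 1 s

theorem zetaMulSub_ne_zero {s : ℂ} (hs : 1 ≤ s.re) : zetaMulSub s ≠ 0 := by
  rcases eq_or_ne s 1 with rfl | h
  · simp [zetaMulSub_one]
  · rw [zetaMulSub_of_ne h]
    exact mul_ne_zero (sub_ne_zero.2 h) (riemannZeta_ne_zero_of_one_le_re hs)

theorem vonMangoldtSubOne_of_ne {s : ℂ} (hs : s ≠ 1) (hζ : riemannZeta s ≠ 0) :
    vonMangoldtSubOne s = -(deriv riemannZeta s / riemannZeta s) - riemannZeta s := by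
  have hs' := sub_ne_zero.2 hs
  have hd : deriv zetaMulSub s = riemannZeta s + (s - 1) * deriv riemannZeta s := by
    have h : HasDerivAt (fun s : ℂ ↦ (s - 1) * riemannZeta s)
        (1 * riemannZeta s + (s - 1) * deriv riemannZeta s) s :=
      ((hasDerivAt_id s).sub_const 1).mul (differentiableAt_riemannZeta hs).hasDerivAt
    rw [one_mul] at h
    refine (h.congr_of_eventuallyEq ?_).deriv
    filter_upwards [eventually_ne_nhds hs] with t ht using zetaMulSub_of_ne ht
  rw [vonMangoldtSubOne, dslope_of_ne _ hs, slope_def_field, hd, zetaMulSub_of_ne hs,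
    zetaMulSub_one]
  field_simp
  ring

theorem differentiableAt_vonMangoldtSubOne {s : ℂ} (hs : zetaMulSub s ≠ 0) :
    DifferentiableAt ℂ vonMangoldtSubOne s := by
  have h1 : DifferentiableAt ℂ (deriv zetaMulSub) s :=
    (differentiable_zetaMulSub.analyticAt s).deriv.differentiableAt
  have h2 : DifferentiableAt ℂ (dslope zetaMulSub 1) s := by
    have := (Complex.differentiableOn_dslope (c := 1) (s := Set.univ) (f := zetaMulSub)
      univ_mem).2 differentiable_zetaMulSub.differentiableOn
    exact this.differentiableAt univ_mem
  exact ((h1.div differentiable_zetaMulSub.differentiableAt hs).neg).sub h2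

theorem exists_zetaMulSub_ne_zero_near_one : ∃ η B : ℝ, 0 < η ∧ 0 < B ∧ ∀ s : ℂ, |s.im| ≤ 1 →
    1 - η ≤ s.re → s.re ≤ 2 → zetaMulSub s ≠ 0 ∧ ‖vonMangoldtSubOne s‖ ≤ B := by
  have hK : IsCompact (Set.Icc (1 : ℝ) 2 ×ℂ Set.Icc (-1 : ℝ) 1) :=
    isCompact_Icc.reProdIm isCompact_Icc
  have hU : IsOpen {s : ℂ | zetaMulSub s ≠ 0} :=
    isOpen_ne_fun differentiable_zetaMulSub.continuous continuous_const
  obtain ⟨δ, hδ, hsub⟩ := hK.exists_cthickening_subset_open hU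
    (fun s hs ↦ zetaMulSub_ne_zero hs.1.1)
  have hmem : ∀ s ∈ Set.Icc (1 - δ) 2 ×ℂ Set.Icc (-1 : ℝ) 1, zetaMulSub s ≠ 0 := by
    rintro s ⟨⟨h1, h2⟩, h3⟩
    refine hsub ?_
    refine Metric.mem_cthickening_of_dist_le s (⟨max 1 s.re, s.im⟩ : ℂ) δ _
      ⟨⟨le_max_left _ _, max_le (by norm_num) h2⟩, h3⟩ ?_
    rw [dist_eq_norm]
    refine (Complex.norm_le_abs_re_add_abs_im _).trans ?_
    simp only [Complex.sub_re, Complex.sub_im, sub_self, abs_zero, add_zero]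
    have h1 : 1 - δ ≤ s.re := h1
    rw [abs_le]
    constructor <;> rcases max_cases 1 s.re with h | h <;> linarith [h.1, h.2]
  have hK' : IsCompact (Set.Icc (1 - δ) 2 ×ℂ Set.Icc (-1 : ℝ) 1) :=
    isCompact_Icc.reProdIm isCompact_Icc
  obtain ⟨B, hB⟩ := hK'.exists_bound_of_continuousOn (f := vonMangoldtSubOne) fun s hs ↦
    (differentiableAt_vonMangoldtSubOne (hmem s hs)).continuousAt.continuousWithinAt
  refine ⟨δ, max B 1, hδ, by positivity, fun s h1 h2 h3 ↦ ?_⟩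
  have hs : s ∈ Set.Icc (1 - δ) 2 ×ℂ Set.Icc (-1 : ℝ) 1 := ⟨⟨h2, h3⟩, abs_le.1 h1⟩
  exact ⟨hmem s hs, (hB s hs).trans (le_max_left _ _)⟩

theorem exists_vonMangoldtSubOne_bound : ∃ a B : ℝ, 0 < a ∧ a ≤ 1 / 4 ∧ 0 < B ∧ ∀ X : ℝ, 6 ≤ X →
    ∀ s : ℂ, 2 * |s.im| + 4 ≤ X → 1 - a / Real.log X ^ 9 ≤ s.re → s.re ≤ 2 →
    zetaMulSub s ≠ 0 ∧ ‖vonMangoldtSubOne s‖ ≤ B * Real.log X ^ 9 := by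
  obtain ⟨a, B, ha, ha4, hB, h⟩ := exists_zeta_zero_free
  obtain ⟨η, B', hη, hB', h'⟩ := exists_zetaMulSub_ne_zero_near_one
  refine ⟨min a η, 2 * B + B', lt_min ha hη, (min_le_left _ _).trans ha4, by positivity,
    fun X hX s hsX hre hre2 ↦ ?_⟩
  have hL := one_le_log_of_four_le (by linarith : 4 ≤ X)
  have hL9 : 1 ≤ Real.log X ^ 9 := one_le_pow₀ hL
  rcases le_total |s.im| 1 with him | him
  · have h1 : min a η / Real.log X ^ 9 ≤ η :=
      (div_le_self (lt_min ha hη).le hL9).trans (min_le_right _ _)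
    obtain ⟨h2, h3⟩ := h' s him (by linarith) hre2
    refine ⟨h2, h3.trans ?_⟩
    nlinarith
  · have h1 : min a η / Real.log X ^ 9 ≤ a / Real.log X ^ 9 := by
      gcongr; exact min_le_left _ _
    obtain ⟨h2, h3, h4⟩ := h X hX s him hsX (by linarith) hre2
    have hs1 : s ≠ 1 := by rintro rfl; simp at him; linarith
    refine ⟨by rw [zetaMulSub_of_ne hs1]; exact mul_ne_zero (sub_ne_zero.2 hs1) h2, ?_⟩
    rw [vonMangoldtSubOne_of_ne hs1 h2]
    refine (norm_sub_le _ _).trans ?_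
    rw [norm_neg]
    nlinarith

/-- The coefficients `Λ(n) - 1` for `n ≥ 1`, and `0` for `n = 0`. -/
noncomputable def vonMangoldtSubOneCoeff (n : ℕ) : ℝ :=
  if n = 0 then 0 else ArithmeticFunction.vonMangoldt n - 1

theorem hasSum_vonMangoldtSubOne {s : ℂ} (hs : 1 < s.re) :
    HasSum (fun n : ℕ ↦ (vonMangoldtSubOneCoeff n : ℂ) * (n : ℂ) ^ (-s)) (vonMangoldtSubOne s) := by
  have hs1 : s ≠ 1 := by rintro rfl; simp at hs
  rw [vonMangoldtSubOne_of_ne hs1 (riemannZeta_ne_zero_of_one_le_re hs.le), ← neg_div,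
    ← ArithmeticFunction.LSeries_vonMangoldt_eq_deriv_riemannZeta_div hs,
    ← LSeries_one_eq_riemannZeta hs]
  have h1 : HasSum (LSeries.term (fun n ↦ (ArithmeticFunction.vonMangoldt n : ℂ)) s) _ :=
    (ArithmeticFunction.LSeriesSummable_vonMangoldt hs).LSeriesHasSum
  have h2 : HasSum (LSeries.term 1 s) _ := (LSeriesSummable_one_iff.2 hs).LSeriesHasSum
  refine (h1.sub h2).congr_fun ?_
  intro n
  rcases eq_or_ne n 0 with rfl | hn
  · simp [vonMangoldtSubOneCoeff]
  · simp [vonMangoldtSubOneCoeff, hn, LSeries.term, Complex.cpow_neg]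
    ring

theorem exists_sum_norm_coeff_le : ∃ C : ℝ, 0 < C ∧ ∀ σ : ℝ, 1 < σ → σ ≤ 2 →
    Summable (fun n : ℕ ↦ |vonMangoldtSubOneCoeff n| * (n : ℝ) ^ (-σ)) ∧
    ∑' n : ℕ, |vonMangoldtSubOneCoeff n| * (n : ℝ) ^ (-σ) ≤ C / (σ - 1) := by
  obtain ⟨a, B, ha, -, hB, h⟩ := exists_vonMangoldtSubOne_bound
  obtain ⟨C₀, hC₀, h₀⟩ := exists_norm_zeta_one_add_le
  refine ⟨B * Real.log 6 ^ 9 + 2 * C₀, by positivity, fun σ hσ hσ2 ↦ ?_⟩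
  have hσ' : 1 < (σ : ℂ).re := by simpa using hσ
  have hF := h 6 le_rfl σ (by simp; norm_num)
    (by simp only [Complex.ofReal_re]
        have : 0 < a / Real.log 6 ^ 9 := by positivity
        linarith) (by simpa using hσ2)
  have hz := h₀ (σ - 1) (by linarith) (by linarith)
  have e : (1 + ((σ - 1 : ℝ) : ℂ)) = σ := by push_cast; ring
  rw [e] at hz
  have hterm : ∀ n : ℕ, ((vonMangoldtSubOneCoeff n + if n = 0 then 0 else 2 : ℝ) : ℂ)
      * (n : ℂ) ^ (-(σ : ℂ)) = (vonMangoldtSubOneCoeff n : ℂ) * (n : ℂ) ^ (-(σ : ℂ))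
        + 2 * LSeries.term 1 (σ : ℂ) n := by
    intro n
    rcases eq_or_ne n 0 with rfl | hn
    · simp [vonMangoldtSubOneCoeff]
    · simp [hn, LSeries.term, Complex.cpow_neg]
      ring
  have hsum : HasSum (fun n : ℕ ↦ ((vonMangoldtSubOneCoeff n + if n = 0 then 0 else 2 : ℝ) : ℂ)
      * (n : ℂ) ^ (-(σ : ℂ))) (vonMangoldtSubOne σ + 2 * riemannZeta σ) := by
    simp_rw [hterm]
    refine (hasSum_vonMangoldtSubOne hσ').add (HasSum.mul_left _ ?_)
    rw [← LSeries_one_eq_riemannZeta hσ']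
    exact (LSeriesSummable_one_iff.2 hσ').LSeriesHasSum
  have hsumR := Complex.hasSum_re hsum
  have hre : ∀ n : ℕ, (((vonMangoldtSubOneCoeff n + if n = 0 then 0 else 2 : ℝ) : ℂ)
      * (n : ℂ) ^ (-(σ : ℂ))).re
      = (vonMangoldtSubOneCoeff n + if n = 0 then 0 else 2) * (n : ℝ) ^ (-σ) := by
    intro n
    rw [← Complex.ofReal_natCast, ← Complex.ofReal_neg, ← Complex.ofReal_cpow (Nat.cast_nonneg n),
      ← Complex.ofReal_mul, Complex.ofReal_re]
  simp_rw [hre] at hsumR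
  have hle : ∀ n : ℕ, |vonMangoldtSubOneCoeff n| * (n : ℝ) ^ (-σ) ≤
      (vonMangoldtSubOneCoeff n + if n = 0 then 0 else 2) * (n : ℝ) ^ (-σ) := by
    intro n
    refine mul_le_mul_of_nonneg_right ?_ (by positivity)
    have hΛ : 0 ≤ ArithmeticFunction.vonMangoldt n := ArithmeticFunction.vonMangoldt_nonneg
    unfold vonMangoldtSubOneCoeff
    split_ifs with hn
    · simp
    · rw [abs_le]; constructor <;> linarith
  have hS : Summable (fun n : ℕ ↦ |vonMangoldtSubOneCoeff n| * (n : ℝ) ^ (-σ)) :=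
    Summable.of_nonneg_of_le (fun n ↦ by positivity) hle hsumR.summable
  refine ⟨hS, (hS.tsum_le_tsum hle hsumR.summable).trans ?_⟩
  rw [hsumR.tsum_eq]
  refine (Complex.re_le_norm _).trans ((norm_add_le _ _).trans ?_)
  rw [norm_mul, Complex.norm_ofNat, add_div]
  have h1 : B * Real.log 6 ^ 9 ≤ B * Real.log 6 ^ 9 / (σ - 1) :=
    le_div_self (by positivity) (by linarith) (by linarith)
  have h2 : 2 * C₀ / (σ - 1) = 2 * (C₀ / (σ - 1)) := by ring
  linarith [hF.2]

theorem norm_inv_mul_add_one_le {s : ℂ} (hs : 3 / 4 ≤ s.re) :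
    ‖(s * (s + 1))⁻¹‖ ≤ 2 * (1 + s.im ^ 2)⁻¹ := by
  have h1 : Complex.normSq s ≤ Complex.normSq (s + 1) := by
    simp only [Complex.normSq_apply, Complex.add_re, Complex.add_im, Complex.one_re,
      Complex.one_im]
    nlinarith
  have h2 : ‖s‖ ≤ ‖s + 1‖ := by
    rw [Complex.normSq_eq_norm_sq, Complex.normSq_eq_norm_sq] at h1
    exact le_of_sq_le_sq h1 (norm_nonneg _)
  have h3 : (1 + s.im ^ 2) / 2 ≤ ‖s‖ * ‖s + 1‖ := by
    have : ‖s‖ ^ 2 = s.re ^ 2 + s.im ^ 2 := by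
      rw [← Complex.normSq_eq_norm_sq, Complex.normSq_apply]; ring
    nlinarith [norm_nonneg s]
  rw [norm_inv, norm_mul]
  have h4 : (0 : ℝ) < 1 + s.im ^ 2 := by positivity
  calc (‖s‖ * ‖s + 1‖)⁻¹ ≤ ((1 + s.im ^ 2) / 2)⁻¹ := inv_anti₀ (by positivity) h3
    _ = _ := by rw [inv_div]; ring

/-- The inverse Mellin transform of `1 / (s (s + 1))` is the Fejér-type kernel `max 0 (1 - u)`. -/
theorem integral_cpow_mul_inv_mul_add_one {σ u : ℝ} (hσ : 3 / 4 ≤ σ) (hu : 0 < u) :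
    ∫ y : ℝ, (u : ℂ) ^ (-(σ + y * Complex.I)) *
      (((σ : ℂ) + y * Complex.I) * ((σ : ℂ) + y * Complex.I + 1))⁻¹
      = 2 * Real.pi * (max 0 (1 - u) : ℝ) := by
  set k : ℝ → ℂ := fun t ↦ (Set.Ioc 0 1).indicator (fun _ ↦ (1 : ℂ)) t
    - (Set.Ioc 0 1).indicator (fun t : ℝ ↦ (t : ℂ) ^ (1 : ℂ)) t with hk
  have hmel : ∀ s : ℂ, 0 < s.re → HasMellin k s ((s * (s + 1))⁻¹) := by
    intro s hs
    have h1 := hasMellin_one_Ioc hs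
    have h2 := hasMellin_cpow_Ioc 1 (s := s) (by simp; linarith)
    have := hasMellin_sub h1.1 h2.1
    rw [h1.2, h2.2] at this
    have e1 : s ≠ 0 := by rintro rfl; simp at hs
    have e2 : s + 1 ≠ 0 := by
      intro h
      have := congrArg Complex.re h
      simp at this; linarith
    rw [show (s * (s + 1))⁻¹ = 1 / s - 1 / (s + 1) by field_simp; ring]
    exact this
  have hkval : ∀ t : ℝ, 0 < t → k t = (max 0 (1 - t) : ℝ) := by
    intro t ht
    rcases le_or_gt t 1 with h | h
    · have : t ∈ Set.Ioc (0 : ℝ) 1 := ⟨ht, h⟩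
      simp [hk, this, max_eq_right (sub_nonneg.2 h)]
    · have : t ∉ Set.Ioc (0 : ℝ) 1 := fun h' ↦ by linarith [h'.2]
      simp [hk, this, max_eq_left (sub_nonpos.2 h.le)]
  have hre : ∀ y : ℝ, ((σ : ℂ) + y * Complex.I).re = σ := by intro y; simp
  have him : ∀ y : ℝ, ((σ : ℂ) + y * Complex.I).im = y := by intro y; simp
  have hm : ∀ y : ℝ, mellin k ((σ : ℂ) + y * Complex.I) =
      (((σ : ℂ) + y * Complex.I) * ((σ : ℂ) + y * Complex.I + 1))⁻¹ :=
    fun y ↦ (hmel _ (by rw [hre]; linarith)).2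
  have hne : ∀ y : ℝ, ((σ : ℂ) + y * Complex.I) * ((σ : ℂ) + y * Complex.I + 1) ≠ 0 := by
    intro y
    refine mul_ne_zero (fun h ↦ ?_) (fun h ↦ ?_) <;>
    · have := congrArg Complex.re h
      simp at this; linarith
  have hvert : Complex.VerticalIntegrable (mellin k) σ := by
    unfold Complex.VerticalIntegrable
    simp_rw [hm]
    refine (integrable_inv_one_add_sq.const_mul 2).mono' ?_ (Eventually.of_forall fun y ↦ ?_)
    · exact (Continuous.inv₀ (by fun_prop) hne).aestronglyMeasurable
    · have := norm_inv_mul_add_one_le (s := (σ : ℂ) + y * Complex.I) (by rw [hre]; exact hσ)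
      rwa [him] at this
  have hcont : ContinuousAt k u := by
    have : Continuous fun t : ℝ ↦ ((max 0 (1 - t) : ℝ) : ℂ) := by fun_prop
    refine this.continuousAt.congr ?_
    filter_upwards [lt_mem_nhds hu] with t ht using (hkval t ht).symm
  have := mellinInv_mellin_eq σ k hu (hmel σ (by simpa using by linarith)).1 hvert hcont
  rw [hkval u hu, mellinInv] at this
  simp_rw [hm, smul_eq_mul] at this
  rw [← this, Complex.real_smul]
  have hpi : (Real.pi : ℂ) ≠ 0 := by exact_mod_cast Real.pi_ne_zero
  rw [← mul_assoc]
  push_cast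
  rw [mul_one_div_cancel (mul_ne_zero two_ne_zero hpi), one_mul]

/-- The integrand of the smoothed Perron formula for the coefficients `Λ(n) - 1`. -/
noncomputable def perronIntegrand (x : ℝ) (s : ℂ) : ℂ :=
  (x : ℂ) ^ s * vonMangoldtSubOne s * (s * (s + 1))⁻¹

theorem norm_perronIntegrand_le {x D : ℝ} {s : ℂ} (hx : 0 < x) (hs : 3 / 4 ≤ s.re)
    (hD : ‖vonMangoldtSubOne s‖ ≤ D) :
    ‖perronIntegrand x s‖ ≤ x ^ s.re * D * 2 * (1 + s.im ^ 2)⁻¹ := by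
  unfold perronIntegrand
  rw [norm_mul, norm_mul, Complex.norm_cpow_eq_rpow_re_of_pos hx]
  calc _ ≤ x ^ s.re * D * (2 * (1 + s.im ^ 2)⁻¹) := by
        gcongr
        · exact mul_nonneg (by positivity) ((norm_nonneg _).trans hD)
        · exact norm_inv_mul_add_one_le hs
    _ = _ := by ring

theorem sum_coeff_mul_sub_eq_integral {x σ : ℝ} (hx : 0 < x) (hσ : 1 < σ) (hσ2 : σ ≤ 2) :
    2 * Real.pi * ((∑ n ∈ range (⌊x⌋₊ + 1), vonMangoldtSubOneCoeff n * (x - n) : ℝ) : ℂ) =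
      x * ∫ y : ℝ, perronIntegrand x (σ + y * Complex.I) := by
  obtain ⟨C, -, hC⟩ := exists_sum_norm_coeff_le
  obtain ⟨hS, -⟩ := hC σ hσ hσ2
  have hre : ∀ y : ℝ, ((σ : ℂ) + y * Complex.I).re = σ := by intro y; simp
  have him : ∀ y : ℝ, ((σ : ℂ) + y * Complex.I).im = y := by intro y; simp
  have hne : ∀ y : ℝ, ((σ : ℂ) + y * Complex.I) * ((σ : ℂ) + y * Complex.I + 1) ≠ 0 := by
    intro y
    refine mul_ne_zero (fun h ↦ ?_) (fun h ↦ ?_) <;>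
    · have := congrArg Complex.re h
      simp at this; linarith
  set F : ℕ → ℝ → ℂ := fun n y ↦ (vonMangoldtSubOneCoeff n : ℂ) *
    (((n / x : ℝ) : ℂ) ^ (-((σ : ℂ) + y * Complex.I)) *
      (((σ : ℂ) + y * Complex.I) * ((σ : ℂ) + y * Complex.I + 1))⁻¹) with hF
  have hF0 : ∀ y, F 0 y = 0 := fun y ↦ by simp [hF, vonMangoldtSubOneCoeff]
  have hbound : ∀ n y, ‖F n y‖ ≤
      |vonMangoldtSubOneCoeff n| * (n : ℝ) ^ (-σ) * x ^ σ * 2 * (1 + y ^ 2)⁻¹ := by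
    intro n y
    rcases eq_or_ne n 0 with rfl | hn
    · rw [hF0, norm_zero]; positivity
    have hn' : (0 : ℝ) < n := by positivity
    simp only [hF]
    rw [norm_mul, norm_mul, Complex.norm_real, Real.norm_eq_abs,
      Complex.norm_cpow_eq_rpow_re_of_pos (by positivity), Complex.neg_re, hre,
      Real.div_rpow hn'.le hx.le, Real.rpow_neg hx.le, div_inv_eq_mul]
    have := norm_inv_mul_add_one_le (s := (σ : ℂ) + y * Complex.I) (by rw [hre]; linarith)
    rw [him] at this
    calc _ ≤ |vonMangoldtSubOneCoeff n| * ((n : ℝ) ^ (-σ) * x ^ σ * (2 * (1 + y ^ 2)⁻¹)) := by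
          gcongr
      _ = _ := by ring
  have hcont : ∀ n, Continuous (F n) := by
    intro n
    rcases eq_or_ne n 0 with rfl | hn
    · rw [show F 0 = fun _ ↦ 0 from funext hF0]; exact continuous_const
    have hnx : ((n / x : ℝ) : ℂ) ≠ 0 := by
      have : (0 : ℝ) < n := by positivity
      exact_mod_cast (div_pos this hx).ne'
    refine continuous_const.mul (Continuous.mul ?_ (Continuous.inv₀ (by fun_prop) hne))
    exact Continuous.const_cpow (by fun_prop) (Or.inl hnx)
  have hinteg : ∀ n, MeasureTheory.Integrable (F n) := fun n ↦
    (integrable_inv_one_add_sq.const_mul _).mono' (hcont n).aestronglyMeasurable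
      (Eventually.of_forall (hbound n))
  have hsummable : Summable fun n ↦ ∫ y, ‖F n y‖ := by
    refine Summable.of_nonneg_of_le
      (fun n ↦ MeasureTheory.integral_nonneg fun y ↦ norm_nonneg _) (fun n ↦ ?_)
      (hS.mul_right (x ^ σ * 2 * Real.pi))
    calc ∫ y, ‖F n y‖ ≤ ∫ y : ℝ, |vonMangoldtSubOneCoeff n| * (n : ℝ) ^ (-σ) * x ^ σ * 2 *
          (1 + y ^ 2)⁻¹ := MeasureTheory.integral_mono (hinteg n).norm
            (integrable_inv_one_add_sq.const_mul _) (hbound n)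
      _ = _ := by rw [MeasureTheory.integral_const_mul, integral_univ_inv_one_add_sq]; ring
  have hmain := MeasureTheory.hasSum_integral_of_summable_integral_norm hinteg hsummable
  have hlhs : ∀ n, ∫ y, F n y =
      (vonMangoldtSubOneCoeff n : ℂ) * (2 * Real.pi * (max 0 (1 - n / x) : ℝ)) := by
    intro n
    rcases eq_or_ne n 0 with rfl | hn
    · simp [hF0, vonMangoldtSubOneCoeff]
    have hn' : (0 : ℝ) < n := by positivity
    simp only [hF]
    rw [MeasureTheory.integral_const_mul,
      integral_cpow_mul_inv_mul_add_one (by linarith) (by positivity)]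
  have hrhs : ∀ y : ℝ, ∑' n, F n y = perronIntegrand x (σ + y * Complex.I) := by
    intro y
    have h := (hasSum_vonMangoldtSubOne (s := (σ : ℂ) + y * Complex.I) (by rwa [hre])).mul_left
      ((x : ℂ) ^ ((σ : ℂ) + y * Complex.I) *
        (((σ : ℂ) + y * Complex.I) * ((σ : ℂ) + y * Complex.I + 1))⁻¹)
    rw [perronIntegrand, mul_right_comm, ← h.tsum_eq]
    refine tsum_congr fun n ↦ ?_
    rcases eq_or_ne n 0 with rfl | hn
    · simp [hF0, vonMangoldtSubOneCoeff]
    simp only [hF]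
    have : ((n / x : ℝ) : ℂ) ^ (-((σ : ℂ) + y * Complex.I)) =
        (n : ℂ) ^ (-((σ : ℂ) + y * Complex.I)) * (x : ℂ) ^ ((σ : ℂ) + y * Complex.I) := by
      rw [div_eq_mul_inv, Complex.ofReal_mul, Complex.mul_cpow_ofReal_nonneg (by positivity)
        (by positivity), Complex.ofReal_natCast, Complex.ofReal_inv, Complex.inv_cpow _ _
        (by rw [Complex.arg_ofReal_of_nonneg hx.le]; exact Real.pi_pos.ne),
        Complex.cpow_neg (x : ℂ), inv_inv]
    rw [this]; ring
  simp_rw [hlhs, hrhs] at hmain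
  have hfin := hmain.unique (hasSum_sum_of_ne_finset_zero (s := range (⌊x⌋₊ + 1)) (fun n hn ↦ by
    have : x < n := by
      rw [mem_range, not_lt] at hn
      exact (Nat.lt_floor_add_one x).trans_le (by exact_mod_cast hn)
    rw [max_eq_left (by rw [sub_nonpos, one_le_div hx]; exact this.le)]; simp))
  rw [hfin, Complex.ofReal_sum, mul_sum, mul_sum]
  refine sum_congr rfl fun n hn ↦ ?_
  have hnx : (n : ℝ) ≤ x := (Nat.le_floor_iff hx.le).1 (Nat.lt_succ_iff.1 (mem_range.1 hn))
  rw [max_eq_right (by rw [sub_nonneg, div_le_one hx]; exact hnx)]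
  have : (x : ℂ) ≠ 0 := by exact_mod_cast hx.ne'
  push_cast
  field_simp

theorem exists_norm_vonMangoldtSubOne_le : ∃ C : ℝ, 0 < C ∧ ∀ s : ℂ, 1 < s.re → s.re ≤ 2 →
    ‖vonMangoldtSubOne s‖ ≤ C / (s.re - 1) := by
  obtain ⟨C, hC, h⟩ := exists_sum_norm_coeff_le
  refine ⟨C, hC, fun s hs hs2 ↦ ?_⟩
  obtain ⟨hS, hle⟩ := h s.re hs hs2
  have hn : ∀ n : ℕ, ‖(vonMangoldtSubOneCoeff n : ℂ) * (n : ℂ) ^ (-s)‖ =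
      |vonMangoldtSubOneCoeff n| * (n : ℝ) ^ (-s.re) := by
    intro n
    rcases eq_or_ne n 0 with rfl | hn
    · simp [vonMangoldtSubOneCoeff]
    · rw [norm_mul, Complex.norm_real, Real.norm_eq_abs,
        Complex.norm_natCast_cpow_of_pos (Nat.pos_of_ne_zero hn), Complex.neg_re]
  rw [← (hasSum_vonMangoldtSubOne hs).tsum_eq]
  refine (norm_tsum_le_tsum_norm (by simpa only [hn] using hS)).trans ?_
  simpa only [hn] using hle

theorem differentiableAt_perronIntegrand {x : ℝ} {s : ℂ} (hx : 0 < x) (hs : 0 < s.re)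
    (hz : zetaMulSub s ≠ 0) : DifferentiableAt ℂ (perronIntegrand x) s := by
  have hx' : (x : ℂ) ≠ 0 := by exact_mod_cast hx.ne'
  have e1 : s ≠ 0 := by rintro rfl; simp at hs
  have e2 : s + 1 ≠ 0 := by
    intro h
    have := congrArg Complex.re h
    simp at this; linarith
  unfold perronIntegrand
  refine ((DifferentiableAt.const_cpow differentiableAt_id (Or.inl hx')).mul
    (differentiableAt_vonMangoldtSubOne hz)).mul (DifferentiableAt.inv (by fun_prop) ?_)
  exact mul_ne_zero e1 e2

/-- Moving a vertical segment across a rectangle on which the integrand is holomorphic. -/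
theorem norm_integral_vertical_le {f : ℂ → ℂ} {p q T : ℝ}
    (hf : DifferentiableOn ℂ f (Set.uIcc p q ×ℂ Set.uIcc (-T) T)) :
    ‖∫ y in -T..T, f (q + y * Complex.I)‖ ≤ ‖∫ y in -T..T, f (p + y * Complex.I)‖ +
      ‖∫ u in p..q, f (u + T * Complex.I)‖ + ‖∫ u in p..q, f (u + (-T : ℝ) * Complex.I)‖ := by
  have h := Complex.integral_boundary_rect_eq_zero_of_differentiableOn f ⟨p, -T⟩ ⟨q, T⟩ hf
  simp only [smul_eq_mul] at h
  set a := ∫ u in p..q, f (u + (-T : ℝ) * Complex.I)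
  set b := ∫ u in p..q, f (u + T * Complex.I)
  set c := ∫ y in -T..T, f (q + y * Complex.I)
  set d := ∫ y in -T..T, f (p + y * Complex.I)
  have e : c = d + -Complex.I * b + Complex.I * a := by
    linear_combination (-Complex.I) * h + (c - d) * Complex.I_sq
  rw [e]
  refine (norm_add₃_le).trans ?_
  simp

theorem integral_Ioi_inv_sq_le {T : ℝ} (hT : 0 < T) :
    ∫ y in Set.Ioi T, (1 + y ^ 2)⁻¹ ≤ 1 / T := by
  rw [integral_Ioi_inv_one_add_sq, ← Real.arctan_inv_of_pos hT, one_div]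
  have h := Real.lt_tan (Real.arctan_pos.2 (inv_pos.2 hT)) (Real.arctan_lt_pi_div_two _)
  rw [Real.tan_arctan] at h
  exact h.le

theorem integral_Iic_inv_sq_le {T : ℝ} (hT : 0 < T) :
    ∫ y in Set.Iic (-T), (1 + y ^ 2)⁻¹ ≤ 1 / T := by
  have := integral_comp_neg_Ioi T (fun y : ℝ ↦ (1 + y ^ 2)⁻¹)
  simp only [neg_sq] at this
  rw [← this]
  exact integral_Ioi_inv_sq_le hT

theorem exists_sum_coeff_mul_sub_le : ∃ a C : ℝ, 0 < a ∧ 0 < C ∧ ∀ x T : ℝ, 3 ≤ x → 1 ≤ T →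
    |∑ n ∈ range (⌊x⌋₊ + 1), vonMangoldtSubOneCoeff n * (x - n)| ≤
      C * x ^ 2 * (Real.log x / T + Real.log (2 * T + 4) ^ 9 / T ^ 2 +
        Real.log (2 * T + 4) ^ 9 * x ^ (-(a / Real.log (2 * T + 4) ^ 9))) := by
  obtain ⟨a, B, ha, ha4, hB, hreg⟩ := exists_vonMangoldtSubOne_bound
  obtain ⟨C, hC, hline⟩ := exists_norm_vonMangoldtSubOne_le
  refine ⟨a, 12 * C + 24 * B + 8 * B, ha, by positivity, fun x T hx hT ↦ ?_⟩
  have hx0 : 0 < x := by linarith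
  have hlogx : 1 ≤ Real.log x := by
    rw [Real.le_log_iff_exp_le hx0]
    exact Real.exp_one_lt_three.le.trans hx
  set X := 2 * T + 4 with hX
  set L := Real.log X with hL
  have hL1 : 1 ≤ L := one_le_log_of_four_le (by linarith)
  have hL9 : 1 ≤ L ^ 9 := one_le_pow₀ hL1
  have hδ : 0 < a / L ^ 9 := by positivity
  have hδ4 : a / L ^ 9 ≤ 1 / 4 := (div_le_self ha.le hL9).trans ha4
  set σ := 1 + 1 / Real.log x with hσ
  have hinv : 0 < 1 / Real.log x := by positivity
  have hinv1 : 1 / Real.log x ≤ 1 := (div_le_one (by linarith)).2 hlogx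
  have hσ1 : 1 < σ := by linarith
  have hσ2 : σ ≤ 2 := by linarith
  have hxσ : x ^ σ ≤ 3 * x := by
    rw [hσ, Real.rpow_add hx0, Real.rpow_one, mul_comm, Real.rpow_def_of_pos hx0,
      mul_one_div_cancel (by linarith)]
    exact mul_le_mul_of_nonneg_right Real.exp_one_lt_three.le hx0.le
  set p := 1 - a / L ^ 9 with hp
  have hxp : x ^ p = x * x ^ (-(a / L ^ 9)) := by
    rw [hp, sub_eq_add_neg, Real.rpow_add hx0, Real.rpow_one]
  have hre : ∀ u y : ℝ, ((u : ℂ) + y * Complex.I).re = u := by intro u y; simp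
  have him : ∀ u y : ℝ, ((u : ℂ) + y * Complex.I).im = y := by intro u y; simp
  have hΦline : ∀ y : ℝ, ‖perronIntegrand x (σ + y * Complex.I)‖ ≤
      6 * x * (C * Real.log x) * (1 + y ^ 2)⁻¹ := by
    intro y
    have h1 := hline (σ + y * Complex.I) (by rwa [hre]) (by rwa [hre])
    have h2 := norm_perronIntegrand_le hx0 (by rw [hre]; linarith) h1
    rw [hre, him, hσ, add_sub_cancel_left, div_div_eq_mul_div, div_one, ← hσ] at h2
    refine h2.trans ?_
    have : x ^ σ * (C * Real.log x) * 2 ≤ 6 * x * (C * Real.log x) := by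
      nlinarith [mul_le_mul_of_nonneg_right hxσ (show 0 ≤ C * Real.log x by positivity)]
    gcongr
  have hrect : ∀ s : ℂ, s ∈ Set.uIcc p σ ×ℂ Set.uIcc (-T) T →
      p ≤ s.re ∧ s.re ≤ σ ∧ zetaMulSub s ≠ 0 ∧ ‖vonMangoldtSubOne s‖ ≤ B * L ^ 9 := by
    intro s hs
    rw [Complex.mem_reProdIm, Set.uIcc_of_le (by linarith), Set.uIcc_of_le (by linarith)] at hs
    have hT' : |s.im| ≤ T := abs_le.2 hs.2
    exact ⟨hs.1.1, hs.1.2, hreg X (by linarith) s (by linarith) hs.1.1 (by linarith [hs.1.2])⟩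
  have hdiff : DifferentiableOn ℂ (perronIntegrand x) (Set.uIcc p σ ×ℂ Set.uIcc (-T) T) :=
    fun s hs ↦ (differentiableAt_perronIntegrand hx0 (by linarith [(hrect s hs).1])
      (hrect s hs).2.2.1).differentiableWithinAt
  have hinteg : MeasureTheory.Integrable fun y : ℝ ↦ perronIntegrand x (σ + y * Complex.I) := by
    refine (integrable_inv_one_add_sq.const_mul _).mono' (Continuous.aestronglyMeasurable ?_)
      (Eventually.of_forall hΦline)
    refine continuous_iff_continuousAt.2 fun y ↦ ?_
    have h1 : ContinuousAt (perronIntegrand x) (σ + y * Complex.I) := by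
      refine (differentiableAt_perronIntegrand hx0 (by rw [hre]; linarith) ?_).continuousAt
      refine (hreg (2 * |y| + 6) (by linarith [abs_nonneg y]) _ (by rw [him]; linarith) ?_
        (by rwa [hre])).1
      rw [hre]
      have : 0 ≤ a / Real.log (2 * |y| + 6) ^ 9 :=
        div_nonneg ha.le (pow_nonneg (Real.log_nonneg (by linarith [abs_nonneg y])) _)
      linarith
    exact ContinuousAt.comp (f := fun y : ℝ ↦ (σ : ℂ) + y * Complex.I) h1
      (Continuous.continuousAt (by fun_prop))
  have htail : ∀ S : Set ℝ, ∫ y in S, (1 + y ^ 2)⁻¹ ≤ 1 / T →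
      ‖∫ y in S, perronIntegrand x (σ + y * Complex.I)‖ ≤
        6 * x * (C * Real.log x) * (1 / T) := by
    intro S hS
    calc _ ≤ ∫ y in S, 6 * x * (C * Real.log x) * (1 + y ^ 2)⁻¹ :=
          MeasureTheory.norm_integral_le_of_norm_le
            (integrable_inv_one_add_sq.const_mul _).integrableOn (Eventually.of_forall hΦline)
      _ ≤ _ := by
          rw [MeasureTheory.integral_const_mul]
          gcongr
  have hhor : ∀ τ : ℝ, |τ| = T → ‖∫ u in p..σ, perronIntegrand x (u + τ * Complex.I)‖ ≤
      12 * x * (B * L ^ 9) / T ^ 2 := by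
    intro τ hτ
    have hle : ∀ u ∈ Set.uIoc p σ, ‖perronIntegrand x (u + τ * Complex.I)‖ ≤
        6 * x * (B * L ^ 9) / T ^ 2 := by
      intro u hu
      rw [Set.uIoc_of_le (by linarith)] at hu
      have hmem : (u + τ * Complex.I : ℂ) ∈ Set.uIcc p σ ×ℂ Set.uIcc (-T) T := by
        rw [Complex.mem_reProdIm, hre, him, Set.uIcc_of_le (by linarith),
          Set.uIcc_of_le (by linarith)]
        exact ⟨⟨hu.1.le, hu.2⟩, abs_le.1 hτ.le⟩
      have h2 := norm_perronIntegrand_le hx0 (by rw [hre]; linarith [hu.1])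
        (hrect _ hmem).2.2.2
      rw [hre, him, ← sq_abs, hτ] at h2
      refine h2.trans ?_
      have h3 : x ^ u ≤ 3 * x :=
        (Real.rpow_le_rpow_of_exponent_le (by linarith) hu.2).trans hxσ
      have h4 : (1 + T ^ 2)⁻¹ ≤ (T ^ 2)⁻¹ := inv_anti₀ (by positivity) (by linarith)
      calc _ ≤ 3 * x * (B * L ^ 9) * 2 * (T ^ 2)⁻¹ := by gcongr
        _ = _ := by ring
    have := intervalIntegral.norm_integral_le_of_norm_le_const hle
    refine this.trans ?_
    rw [abs_of_nonneg (by linarith)]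
    have : 6 * x * (B * L ^ 9) / T ^ 2 * (σ - p) ≤ 6 * x * (B * L ^ 9) / T ^ 2 * 2 :=
      mul_le_mul_of_nonneg_left (by linarith) (by positivity)
    refine this.trans (le_of_eq (by ring))
  have hleft : ‖∫ y in -T..T, perronIntegrand x (p + y * Complex.I)‖ ≤
      x ^ p * (B * L ^ 9) * 2 * Real.pi := by
    have hle : ∀ y ∈ Set.Ioc (-T) T, ‖perronIntegrand x (p + y * Complex.I)‖ ≤
        x ^ p * (B * L ^ 9) * 2 * (1 + y ^ 2)⁻¹ := by
      intro y hy
      have hmem : (p + y * Complex.I : ℂ) ∈ Set.uIcc p σ ×ℂ Set.uIcc (-T) T := by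
        rw [Complex.mem_reProdIm, hre, him, Set.uIcc_of_le (by linarith),
          Set.uIcc_of_le (by linarith)]
        exact ⟨⟨le_rfl, by linarith⟩, hy.1.le, hy.2⟩
      have h2 := norm_perronIntegrand_le hx0 (by rw [hre]; linarith)
        (hrect _ hmem).2.2.2
      rwa [hre, him] at h2
    rw [intervalIntegral.integral_of_le (by linarith)]
    calc _ ≤ ∫ y in Set.Ioc (-T) T, x ^ p * (B * L ^ 9) * 2 * (1 + y ^ 2)⁻¹ :=
          MeasureTheory.norm_integral_le_of_norm_le
            (integrable_inv_one_add_sq.const_mul _).integrableOn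
            ((MeasureTheory.ae_restrict_iff' measurableSet_Ioc).2 (Eventually.of_forall hle))
      _ ≤ ∫ y : ℝ, x ^ p * (B * L ^ 9) * 2 * (1 + y ^ 2)⁻¹ :=
          MeasureTheory.setIntegral_le_integral (integrable_inv_one_add_sq.const_mul _)
            (Eventually.of_forall fun y ↦ by positivity)
      _ = _ := by
          rw [MeasureTheory.integral_const_mul, integral_univ_inv_one_add_sq]
  have hsplit : ∫ y : ℝ, perronIntegrand x (σ + y * Complex.I) =
      (∫ y in Set.Iic (-T), perronIntegrand x (σ + y * Complex.I)) +
      (∫ y in -T..T, perronIntegrand x (σ + y * Complex.I)) +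
      ∫ y in Set.Ioi T, perronIntegrand x (σ + y * Complex.I) := by
    rw [← intervalIntegral.integral_Iic_add_Ioi (b := T) hinteg.integrableOn hinteg.integrableOn,
      ← intervalIntegral.integral_Iic_sub_Iic (a := -T) (b := T) hinteg.integrableOn
        hinteg.integrableOn]
    ring
  have htot := (norm_add₃_le (a := ∫ y in Set.Iic (-T), perronIntegrand x (σ + y * Complex.I))
    (b := ∫ y in -T..T, perronIntegrand x (σ + y * Complex.I))
    (c := ∫ y in Set.Ioi T, perronIntegrand x (σ + y * Complex.I)))
  rw [← hsplit] at htot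
  have h1 := htail _ (integral_Iic_inv_sq_le (by linarith : 0 < T))
  have h2 := htail _ (integral_Ioi_inv_sq_le (by linarith : 0 < T))
  have h3 := norm_integral_vertical_le hdiff
  have h4 := hhor T (abs_of_nonneg (by linarith))
  have h5 := hhor (-T) (by rw [abs_neg]; exact abs_of_nonneg (by linarith))
  have hI : ‖∫ y : ℝ, perronIntegrand x (σ + y * Complex.I)‖ ≤
      x * (12 * C * (Real.log x / T) + 24 * B * (L ^ 9 / T ^ 2)
        + 8 * B * (L ^ 9 * x ^ (-(a / L ^ 9)))) := by
    have h6 : x ^ p * (B * L ^ 9) * 2 * Real.pi ≤ x ^ p * (B * L ^ 9) * 2 * 4 := by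
      gcongr; exact Real.pi_le_four
    rw [hxp] at h6 hleft
    have e : x * (12 * C * (Real.log x / T) + 24 * B * (L ^ 9 / T ^ 2)
        + 8 * B * (L ^ 9 * x ^ (-(a / L ^ 9)))) =
      2 * (6 * x * (C * Real.log x) * (1 / T)) + 2 * (12 * x * (B * L ^ 9) / T ^ 2) +
      x * x ^ (-(a / L ^ 9)) * (B * L ^ 9) * 2 * 4 := by ring
    rw [e]
    linarith
  have hP := congrArg norm (sum_coeff_mul_sub_eq_integral hx0 hσ1 hσ2)
  rw [norm_mul, norm_mul, Complex.norm_real, Real.norm_eq_abs, norm_mul, Complex.norm_ofNat,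
    Complex.norm_real, Real.norm_eq_abs, abs_of_pos Real.pi_pos, Complex.norm_real,
    Real.norm_eq_abs, abs_of_pos hx0] at hP
  set W := |∑ n ∈ range (⌊x⌋₊ + 1), vonMangoldtSubOneCoeff n * (x - n)|
  have hW : W ≤ 2 * Real.pi * W := by
    have : 0 ≤ W := abs_nonneg _
    nlinarith [Real.pi_gt_three]
  set E1 := Real.log x / T
  set E2 := L ^ 9 / T ^ 2
  set E3 := L ^ 9 * x ^ (-(a / L ^ 9))
  have hE1 : 0 ≤ E1 := by positivity
  have hE2 : 0 ≤ E2 := by positivity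
  have hE3 : 0 ≤ E3 := by positivity
  calc W ≤ x * (x * (12 * C * E1 + 24 * B * E2 + 8 * B * E3)) := by
        refine hW.trans (hP.le.trans ?_)
        gcongr
    _ = x ^ 2 * (12 * C * E1 + 24 * B * E2 + 8 * B * E3) := by ring
    _ ≤ x ^ 2 * ((12 * C + 24 * B + 8 * B) * (E1 + E2 + E3)) := by
        refine mul_le_mul_of_nonneg_left ?_ (by positivity)
        have : 0 ≤ (24 * B + 8 * B) * E1 + (12 * C + 8 * B) * E2 + (12 * C + 24 * B) * E3 := by
          positivity
        linarith
    _ = _ := by ring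

theorem one_le_log_of_three_le {x : ℝ} (hx : 3 ≤ x) : 1 ≤ Real.log x := by
  rw [Real.le_log_iff_exp_le (by linarith)]
  exact Real.exp_one_lt_three.le.trans hx

theorem exists_sum_coeff_mul_sub_le_log_pow (k : ℕ) : ∃ C : ℝ, 0 < C ∧ ∀ x : ℝ, 3 ≤ x →
    |∑ n ∈ range (⌊x⌋₊ + 1), vonMangoldtSubOneCoeff n * (x - n)| ≤
      C * x ^ 2 / Real.log x ^ k := by
  obtain ⟨a, C, ha, hC, h⟩ := exists_sum_coeff_mul_sub_le
  set D : ℝ := (2 + 18 * (k + 1)) ^ 9 with hD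
  have hD0 : 0 < D := by positivity
  set M : ℝ := D * (2 * k + 1).factorial * (D / a) ^ (2 * k + 1) with hM
  have hM0 : 0 < M := by positivity
  refine ⟨C * (1 + D + M), by positivity, fun x hx ↦ ?_⟩
  have hx0 : 0 < x := by linarith
  have hv := one_le_log_of_three_le hx
  set v := Real.log x with hvdef
  have hv0 : 0 < v := by linarith
  set w := Real.sqrt v with hw
  have hw1 : 1 ≤ w := Real.one_le_sqrt.2 hv
  have hw0 : 0 < w := by linarith
  have hwv : w ^ 2 = v := Real.sq_sqrt hv0.le
  have hT : 1 ≤ v ^ (k + 1) := one_le_pow₀ hv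
  have h := h x (v ^ (k + 1)) hx hT
  set L := Real.log (2 * v ^ (k + 1) + 4) with hL
  have hL1 : 1 ≤ L := one_le_log_of_four_le (by linarith)
  have hlog6 : Real.log 6 ≤ 2 := by
    rw [Real.log_le_iff_le_exp (by norm_num)]
    have := Real.exp_one_gt_d9
    calc (6 : ℝ) ≤ Real.exp 1 * Real.exp 1 := by nlinarith
      _ = Real.exp 2 := by rw [← Real.exp_add]; norm_num
  have hLle : L ≤ (2 + 18 * (k + 1)) * v ^ (1 / 18 : ℝ) := by
    have h1 : L ≤ Real.log (6 * v ^ (k + 1)) := Real.log_le_log (by positivity) (by linarith)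
    rw [Real.log_mul (by norm_num) (by positivity), Real.log_pow] at h1
    have h2 := Real.log_le_rpow_div hv0.le (show (0 : ℝ) < 1 / 18 by norm_num)
    have h3 : 1 ≤ v ^ (1 / 18 : ℝ) := Real.one_le_rpow hv (by norm_num)
    have h4 : ((k + 1 : ℕ) : ℝ) * Real.log v ≤ (k + 1) * (18 * v ^ (1 / 18 : ℝ)) := by
      push_cast
      gcongr
      linarith
    linarith
  have hL9 : L ^ 9 ≤ D * w := by
    calc L ^ 9 ≤ ((2 + 18 * (k + 1)) * v ^ (1 / 18 : ℝ)) ^ 9 := by gcongr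
      _ = D * w := by
        rw [mul_pow, ← Real.rpow_natCast (v ^ (1 / 18 : ℝ)), ← Real.rpow_mul hv0.le, hw,
          Real.sqrt_eq_rpow]
        norm_num [hD]
  have hE1 : v / v ^ (k + 1) = 1 / v ^ k := by
    field_simp
    ring
  have hE2 : L ^ 9 / (v ^ (k + 1)) ^ 2 ≤ D * (1 / v ^ k) := by
    rw [mul_one_div, div_le_div_iff₀ (by positivity) (by positivity)]
    have : w ≤ v := by nlinarith
    calc L ^ 9 * v ^ k ≤ D * v * v ^ k := by gcongr; exact hL9.trans (by gcongr)
      _ = D * (v ^ (k + 1) * 1) := by ring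
      _ ≤ D * (v ^ (k + 1) * v ^ (k + 1)) := by gcongr
      _ = _ := by ring
  have hE3 : L ^ 9 * x ^ (-(a / L ^ 9)) ≤ M * (1 / v ^ k) := by
    have h1 : a / D * w ≤ a / L ^ 9 * v := by
      rw [div_mul_eq_mul_div, div_mul_eq_mul_div, div_le_div_iff₀ hD0 (by positivity)]
      calc a * w * L ^ 9 ≤ a * w * (D * w) := by gcongr
        _ = a * w ^ 2 * D := by ring
        _ = _ := by rw [hwv]
    have h2 := Real.pow_div_factorial_le_exp (a / D * w) (by positivity) (2 * k + 1)
    have h3 : x ^ (-(a / L ^ 9)) ≤ (2 * k + 1).factorial / (a / D * w) ^ (2 * k + 1) := by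
      rw [Real.rpow_def_of_pos hx0, mul_neg, Real.exp_neg, ← inv_div ((a / D * w) ^ (2 * k + 1))]
      refine inv_anti₀ (by positivity) (h2.trans (Real.exp_le_exp.2 (h1.trans_eq ?_)))
      rw [mul_comm]
    calc L ^ 9 * x ^ (-(a / L ^ 9))
        ≤ D * w * ((2 * k + 1).factorial / (a / D * w) ^ (2 * k + 1)) := by gcongr
      _ = M * (1 / v ^ k) := by
        have hr : 0 < a / D := by positivity
        rw [hM, ← hwv, ← inv_div a D, mul_pow, inv_pow]
        field_simp
        ring
  refine h.trans ?_
  rw [hE1]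
  calc _ ≤ C * x ^ 2 * (1 / v ^ k + D * (1 / v ^ k) + M * (1 / v ^ k)) := by gcongr
    _ = _ := by ring

/-- The smoothed Chebyshev sum `∑_{n ≤ x} Λ(n) (x - n)`. -/
noncomputable def smoothedPsi (x : ℝ) : ℝ :=
  ∑ n ∈ range (⌊x⌋₊ + 1), ArithmeticFunction.vonMangoldt n * (x - n)

theorem sum_coeff_mul_sub_eq (x : ℝ) :
    ∑ n ∈ range (⌊x⌋₊ + 1), vonMangoldtSubOneCoeff n * (x - n) =
      smoothedPsi x - (⌊x⌋₊ * x - ⌊x⌋₊ * (⌊x⌋₊ + 1) / 2) := by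
  have key : ∀ N : ℕ, ∑ n ∈ range (N + 1), vonMangoldtSubOneCoeff n * (x - n) =
      ∑ n ∈ range (N + 1), ArithmeticFunction.vonMangoldt n * (x - n) -
        (N * x - N * (N + 1) / 2) := by
    intro N
    induction N with
    | zero => simp [vonMangoldtSubOneCoeff]
    | succ N ih =>
      rw [sum_range_succ, ih, sum_range_succ _ (N + 1), vonMangoldtSubOneCoeff,
        if_neg N.succ_ne_zero]
      push_cast
      ring
  exact key _

theorem log_pow_le_factorial_mul {x : ℝ} (hx : 1 ≤ x) (k : ℕ) :
    Real.log x ^ k ≤ k.factorial * x := by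
  have := Real.pow_div_factorial_le_exp (Real.log x) (Real.log_nonneg hx) k
  rw [Real.exp_log (by linarith), div_le_iff₀ (by positivity)] at this
  linarith

theorem exists_smoothedPsi_sub_le (k : ℕ) : ∃ C : ℝ, 0 < C ∧ ∀ x : ℝ, 3 ≤ x →
    |smoothedPsi x - x ^ 2 / 2| ≤ C * x ^ 2 / Real.log x ^ k := by
  obtain ⟨C, hC, h⟩ := exists_sum_coeff_mul_sub_le_log_pow k
  refine ⟨C + k.factorial, by positivity, fun x hx ↦ ?_⟩
  have h1 := h x hx
  rw [sum_coeff_mul_sub_eq] at h1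
  have hv := one_le_log_of_three_le hx
  have hf1 := Nat.floor_le (by linarith : 0 ≤ x)
  have hf2 := Nat.lt_floor_add_one x
  set N : ℝ := (⌊x⌋₊ : ℝ)
  have h2 : |(N * x - N * (N + 1) / 2) - x ^ 2 / 2| ≤ x := by
    have e : (N * x - N * (N + 1) / 2) - x ^ 2 / 2 = -((x - N) ^ 2 / 2 + N / 2) := by ring
    have h0 : (x - N) ^ 2 ≤ 1 := by nlinarith
    have h0' : 0 ≤ (x - N) ^ 2 := sq_nonneg _
    rw [e, abs_neg, abs_le]
    constructor <;> linarith
  have h3 : x ≤ k.factorial * x ^ 2 / Real.log x ^ k := by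
    rw [le_div_iff₀ (by positivity)]
    nlinarith [log_pow_le_factorial_mul (by linarith : 1 ≤ x) k]
  calc |smoothedPsi x - x ^ 2 / 2|
      = |(smoothedPsi x - (N * x - N * (N + 1) / 2)) +
        ((N * x - N * (N + 1) / 2) - x ^ 2 / 2)| := by congr 1; ring
    _ ≤ C * x ^ 2 / Real.log x ^ k + k.factorial * x ^ 2 / Real.log x ^ k :=
        (abs_add_le _ _).trans (add_le_add h1 (h2.trans h3))
    _ = _ := by ring

theorem smoothedPsi_eq_sum_max {x : ℝ} (hx : 0 ≤ x) {N : ℕ} (hN : ⌊x⌋₊ + 1 ≤ N) :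
    smoothedPsi x = ∑ n ∈ range N, ArithmeticFunction.vonMangoldt n * max 0 (x - n) := by
  rw [smoothedPsi, ← sum_subset (range_subset_range.2 hN)]
  · refine sum_congr rfl fun n hn ↦ ?_
    have hnx : (n : ℝ) ≤ x := (Nat.le_floor_iff hx).1 (Nat.lt_succ_iff.1 (mem_range.1 hn))
    rw [max_eq_right (by linarith)]
  · intro n _ hn
    have : x < n := by
      rw [mem_range, not_lt] at hn
      exact (Nat.lt_floor_add_one x).trans_le (by exact_mod_cast hn)
    rw [max_eq_left (by linarith), mul_zero]

theorem smoothedPsi_add_mul_psi_le {x y : ℝ} (hy : 0 ≤ y) :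
    smoothedPsi x + (y - x) * Chebyshev.psi x ≤ smoothedPsi y := by
  rw [smoothedPsi_eq_sum_max hy (le_max_right (⌊x⌋₊ + 1) (⌊y⌋₊ + 1)),
    Chebyshev.psi_eq_sum_Icc, ← Nat.range_succ_eq_Icc_zero, smoothedPsi, mul_sum,
    ← sum_add_distrib]
  calc _ ≤ ∑ n ∈ range (⌊x⌋₊ + 1), ArithmeticFunction.vonMangoldt n * max 0 (y - n) := by
        refine sum_le_sum fun n _ ↦ ?_
        have := mul_le_mul_of_nonneg_left (le_max_right 0 (y - n))
          (ArithmeticFunction.vonMangoldt_nonneg (n := n))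
        linarith
    _ ≤ _ := sum_le_sum_of_subset_of_nonneg (range_subset_range.2 (le_max_left _ _))
        fun n _ _ ↦ mul_nonneg ArithmeticFunction.vonMangoldt_nonneg (le_max_left _ _)

theorem exists_psi_sub_le (m : ℕ) (hm : m ≠ 0) : ∃ C : ℝ, 0 < C ∧ ∀ x : ℝ, 16 ≤ x →
    |Chebyshev.psi x - x| ≤ C * x / Real.log x ^ m := by
  obtain ⟨C, hC, h⟩ := exists_smoothedPsi_sub_le (2 * m)
  set C' : ℝ := C * 4 * 4 ^ m with hC'
  refine ⟨1 / 2 + 2 * C', by positivity, fun x hx ↦ ?_⟩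
  have hx0 : 0 < x := by linarith
  set v := Real.log x with hvdef
  have hlog2 : Real.log 2 ≤ 1 := by linarith [Real.log_two_lt_d9]
  have hv : 2 ≤ v := by
    have h16 : Real.log 16 = 4 * Real.log 2 := by
      rw [show (16 : ℝ) = 2 ^ 4 by norm_num, Real.log_pow]; norm_num
    have := Real.log_le_log (by norm_num) hx
    linarith [Real.log_two_gt_d9]
  have hv0 : 0 < v := by linarith
  have hvm : 2 ≤ v ^ m := hv.trans (le_self_pow₀ (by linarith) hm)
  set d := x / v ^ m with hd
  have hd0 : 0 < d := by positivity
  have hd2 : d ≤ x / 2 := div_le_div_of_nonneg_left hx0.le (by norm_num) hvm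
  have hd2' : x ^ 2 / v ^ (2 * m) = d ^ 2 := by rw [hd, div_pow, ← pow_mul, mul_comm m]
  have hS : ∀ y : ℝ, x / 2 ≤ y → y ≤ 2 * x → |smoothedPsi y - y ^ 2 / 2| ≤ C' * d ^ 2 := by
    intro y hy1 hy2
    refine (h y (by linarith)).trans ?_
    have hlog : v / 2 ≤ Real.log y := by
      have := Real.log_le_log (by positivity) hy1
      rw [Real.log_div hx0.ne' (by norm_num)] at this
      linarith
    calc C * y ^ 2 / Real.log y ^ (2 * m) ≤ C * (2 * x) ^ 2 / (v / 2) ^ (2 * m)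
          := by gcongr; linarith
      _ = C' * (x ^ 2 / v ^ (2 * m)) := by
        rw [hC', div_pow, pow_mul 2 2 m]
        norm_num
        field_simp
        ring
      _ = _ := by rw [hd2']
  have h0 := abs_le.1 (hS x (by linarith) (by linarith))
  have hp := abs_le.1 (hS (x + d) (by linarith) (by linarith))
  have hn := abs_le.1 (hS (x - d) (by linarith) (by linarith))
  have kp := smoothedPsi_add_mul_psi_le (x := x) (y := x + d) (by linarith)
  have kn := smoothedPsi_add_mul_psi_le (x := x) (y := x - d) (by linarith)
  have e : (1 / 2 + 2 * C') * x / v ^ m = (1 / 2 + 2 * C') * d := by rw [hd]; ring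
  rw [e, abs_le]
  constructor
  · refine le_of_mul_le_mul_left ?_ hd0
    nlinarith
  · refine le_of_mul_le_mul_left ?_ hd0
    nlinarith

/-- The prime number theorem with an error term saving an arbitrary power of the logarithm. -/
theorem exists_theta_sub_le {A : ℝ} (hA : 0 < A) : ∃ C : ℝ, 0 < C ∧ ∀ x : ℝ, 3 / 2 ≤ x →
    |Chebyshev.theta x - x| ≤ C * (x / Real.log x ^ A) := by
  obtain ⟨m, hm⟩ := exists_nat_ge A
  have hm0 : m ≠ 0 := by
    rintro rfl
    norm_num at hm
    linarith
  obtain ⟨C₁, hC₁, h₁⟩ := exists_psi_sub_le m hm0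
  obtain ⟨C₂, h₂⟩ := Chebyshev.psi_sub_theta_le_mul_sqrt
  refine ⟨C₁ + |C₂| * (2 ^ m * m.factorial) + 3 * 4 ^ A, by positivity, fun x hx ↦ ?_⟩
  have hx0 : 0 < x := by linarith
  have hv0 : 0 < Real.log x := Real.log_pos (by linarith)
  set v := Real.log x with hvdef
  have hE : 0 ≤ x / v ^ A := by positivity
  rcases le_or_gt 16 x with hx16 | hx16
  · have hv := one_le_log_of_three_le (show 3 ≤ x by linarith)
    have hle : x / v ^ m ≤ x / v ^ A := by
      refine div_le_div_of_nonneg_left hx0.le (by positivity) ?_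
      rw [← Real.rpow_natCast]
      exact Real.rpow_le_rpow_of_exponent_le hv hm
    have hsq : 0 < √x := Real.sqrt_pos.2 hx0
    have hsqrt : √x ≤ 2 ^ m * m.factorial * (x / v ^ m) := by
      have h3 := log_pow_le_factorial_mul (x := √x) (Real.one_le_sqrt.2 (by linarith)) m
      rw [Real.log_sqrt hx0.le, div_pow, div_le_iff₀ (by positivity)] at h3
      rw [mul_div_assoc', le_div_iff₀ (by positivity)]
      calc √x * v ^ m ≤ √x * (m.factorial * √x * 2 ^ m) := by gcongr
        _ = 2 ^ m * m.factorial * (√x * √x) := by ring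
        _ = _ := by rw [Real.mul_self_sqrt hx0.le]
    have h4 := h₂ x
    have h5 := Chebyshev.theta_le_psi x
    have h6 : |Chebyshev.theta x - x| ≤ |Chebyshev.psi x - x| + |C₂| * √x := by
      have h7 : C₂ * √x ≤ |C₂| * √x := by gcongr; exact le_abs_self _
      have h8 := abs_le.1 (le_refl |Chebyshev.psi x - x|)
      have h9 : 0 ≤ |C₂| * √x := by positivity
      rw [abs_le]
      constructor <;> linarith
    calc _ ≤ C₁ * x / v ^ m + |C₂| * (2 ^ m * m.factorial * (x / v ^ m)) :=
          h6.trans (by gcongr; exact h₁ x hx16)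
      _ = (C₁ + |C₂| * (2 ^ m * m.factorial)) * (x / v ^ m) := by ring
      _ ≤ (C₁ + |C₂| * (2 ^ m * m.factorial)) * (x / v ^ A) := by gcongr
      _ ≤ _ := by
          have : (0 : ℝ) ≤ 3 * 4 ^ A := by positivity
          exact mul_le_mul_of_nonneg_right (by linarith) hE
  · have h1 := Chebyshev.theta_le_log4_mul_x hx0.le
    have h2 := Chebyshev.theta_nonneg x
    have hlog2 := Real.log_two_lt_d9
    have h4 : Real.log 4 ≤ 2 := by
      rw [show (4 : ℝ) = 2 ^ 2 by norm_num, Real.log_pow]; norm_num; linarith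
    have hv4 : v ≤ 4 := by
      have h16 : Real.log 16 = 4 * Real.log 2 := by
        rw [show (16 : ℝ) = 2 ^ 4 by norm_num, Real.log_pow]; norm_num
      have := Real.log_le_log hx0 hx16.le
      linarith
    have h5 : |Chebyshev.theta x - x| ≤ 3 * x := by
      rw [abs_le]
      constructor <;> nlinarith
    have h6 : v ^ A ≤ 4 ^ A := Real.rpow_le_rpow hv0.le hv4 hA.le
    calc _ ≤ 3 * x := h5
      _ ≤ 3 * 4 ^ A * (x / v ^ A) := by
          rw [mul_div_assoc', le_div_iff₀ (by positivity)]
          nlinarith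
      _ ≤ _ := by
          have : 0 ≤ |C₂| * (2 ^ m * (m.factorial : ℝ)) := by positivity
          exact mul_le_mul_of_nonneg_right (by linarith) hE

theorem exists_rpow_div_log_rpow_le {b A : ℝ} (hb : 0 < b) (hA : 0 < A) : ∃ C : ℝ, 0 < C ∧
    ∀ t x : ℝ, 3 / 2 ≤ t → t ≤ x → t ^ b / Real.log t ^ A ≤ C * (x ^ b / Real.log x ^ A) := by
  have hl : 0 < Real.log (3 / 2) := Real.log_pos (by norm_num)
  set M : ℝ := 1 + A / b / Real.log (3 / 2) with hM
  have hM0 : 0 < M := by positivity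
  refine ⟨M ^ A, by positivity, fun t x ht htx ↦ ?_⟩
  have ht0 : 0 < t := by linarith
  have hx0 : 0 < x := by linarith
  have hlt : Real.log (3 / 2) ≤ Real.log t := Real.log_le_log (by norm_num) ht
  have hlt0 : 0 < Real.log t := hl.trans_le hlt
  have hlx0 : 0 < Real.log x := hlt0.trans_le (Real.log_le_log ht0 htx)
  have hxt : 1 ≤ x / t := (one_le_div ht0).2 htx
  have hlog : Real.log x ≤ M * (x / t) ^ (b / A) * Real.log t := by
    have h1 := Real.log_le_rpow_div (by positivity : 0 ≤ x / t) (by positivity : 0 < b / A)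
    have h2 : 1 ≤ (x / t) ^ (b / A) := Real.one_le_rpow hxt (by positivity)
    set z := (x / t) ^ (b / A)
    rw [Real.log_div hx0.ne' ht0.ne', div_div_eq_mul_div] at h1
    have h3 : z * A / b ≤ A / b / Real.log (3 / 2) * z * Real.log t := by
      calc z * A / b = A / b / Real.log (3 / 2) * z * Real.log (3 / 2) := by field_simp
        _ ≤ _ := by gcongr
    rw [hM]
    nlinarith
  have hpow := Real.rpow_le_rpow hlx0.le hlog hA.le
  rw [Real.mul_rpow (by positivity) hlt0.le, Real.mul_rpow hM0.le (by positivity),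
    ← Real.rpow_mul (by positivity), div_mul_cancel₀ _ hA.ne', Real.div_rpow hx0.le ht0.le] at hpow
  rw [mul_div_assoc', div_le_div_iff₀ (by positivity) (by positivity)]
  calc t ^ b * Real.log x ^ A ≤ t ^ b * (M ^ A * (x ^ b / t ^ b) * Real.log t ^ A) := by gcongr
    _ = _ := by field_simp

theorem sum_primes_eq_integral_theta {g : ℝ → ℝ} {y x : ℝ} (hy : 0 ≤ y) (hyx : y ≤ x)
    (hg : ∀ t ∈ Set.Icc y x, DifferentiableAt ℝ g t)
    (hg' : MeasureTheory.IntegrableOn (deriv g) (Set.Icc y x)) :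
    ∑ p ∈ (Icc 2 ⌊x⌋₊).filter (fun p : ℕ ↦ p.Prime ∧ y < (p : ℝ)), g p * Real.log p
      - ∫ t in y..x, g t = g x * (Chebyshev.theta x - x) - g y * (Chebyshev.theta y - y)
        - ∫ t in y..x, deriv g t * (Chebyshev.theta t - t) := by
  set c : ℕ → ℝ := fun n ↦ if n.Prime then Real.log n else 0 with hc
  have hθ : ∀ t : ℝ, ∑ k ∈ Icc 0 ⌊t⌋₊, c k = Chebyshev.theta t := by
    intro t
    rw [Chebyshev.theta_eq_sum_Icc, sum_filter]
  have habel := sum_mul_eq_sub_sub_integral_mul c hy hyx hg hg'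
  have hinteg := integrableOn_mul_sum_Icc (m := 0) c hy hg'
  simp only [hθ] at habel hinteg
  have hsum : ∑ p ∈ (Icc 2 ⌊x⌋₊).filter (fun p : ℕ ↦ p.Prime ∧ y < (p : ℝ)), g p * Real.log p =
      ∑ k ∈ Ioc ⌊y⌋₊ ⌊x⌋₊, g k * c k := by
    simp only [hc, mul_ite, mul_zero]
    rw [← sum_filter]
    refine sum_congr ?_ fun _ _ ↦ rfl
    ext p
    simp only [mem_filter, mem_Icc, mem_Ioc, Nat.floor_lt hy]
    constructor
    · rintro ⟨⟨-, h1⟩, h2, h3⟩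
      exact ⟨⟨h3, h1⟩, h2⟩
    · rintro ⟨⟨h3, h1⟩, h2⟩
      exact ⟨⟨h2.two_le, h1⟩, h2, h3⟩
  have hg'i : IntervalIntegrable (deriv g) MeasureTheory.volume y x :=
    (intervalIntegrable_iff_integrableOn_Icc_of_le hyx).2 hg'
  have hparts := intervalIntegral.integral_mul_deriv_eq_deriv_mul (u := fun t ↦ t)
    (u' := fun _ ↦ (1 : ℝ)) (v := g) (v' := deriv g) (a := y) (b := x)
    (fun t _ ↦ hasDerivAt_id t)
    (fun t ht ↦ (hg t (by rwa [Set.uIcc_of_le hyx] at ht)).hasDerivAt)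
    intervalIntegrable_const hg'i
  have hi1 : IntervalIntegrable (fun t ↦ deriv g t * Chebyshev.theta t)
      MeasureTheory.volume y x := (intervalIntegrable_iff_integrableOn_Icc_of_le hyx).2 hinteg
  have hi2 : IntervalIntegrable (fun t ↦ t * deriv g t) MeasureTheory.volume y x :=
    hg'i.continuousOn_mul continuousOn_id
  have hsub : ∫ t in y..x, deriv g t * (Chebyshev.theta t - t) =
      (∫ t in y..x, deriv g t * Chebyshev.theta t) - ∫ t in y..x, t * deriv g t := by
    rw [← intervalIntegral.integral_sub hi1 hi2]
    exact intervalIntegral.integral_congr fun t _ ↦ by ring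
  rw [← intervalIntegral.integral_of_le hyx] at habel
  simp only [one_mul] at hparts
  rw [hsum, habel, hsub, hparts]
  ring

/-- Jia's Lemma 3, case `c > -1`: if `f` is differentiable on `[1, ∞)` with
`f(x) = O(x^c)` and `f'(x) = O(x^{c-1})`, then for every `A > 0` there is a constant `M`
such that for all `3/2 < y ≤ x`,
`Σ_{y < p ≤ x} f(p) = ∫_y^x f(t)/log t dt + O(x^{c+1}/(log x)^A)`. -/
theorem prime_sum_asymptotic_large_exponent
    (c : ℝ) (hc : -1 < c) (f : ℝ → ℝ)
    (hdiff : ∀ x : ℝ, 1 ≤ x → DifferentiableAt ℝ f x)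
    (K : ℝ) (hf : ∀ x : ℝ, 1 ≤ x → |f x| ≤ K * x ^ c)
    (hf' : ∀ x : ℝ, 1 ≤ x → |deriv f x| ≤ K * x ^ (c - 1))
    (A : ℝ) (hA : 0 < A) :
    ∃ M : ℝ, ∀ y x : ℝ, 3 / 2 < y → y ≤ x →
      |(∑ p ∈ (Finset.Icc 2 ⌊x⌋₊).filter (fun p : ℕ => p.Prime ∧ y < (p : ℝ)),
          f (p : ℝ))
        - ∫ t in y..x, f t / Real.log t| ≤ M * (x ^ (c + 1) / Real.log x ^ A) := by
  have hK : 0 ≤ K := by simpa using (abs_nonneg _).trans (hf 1 le_rfl)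
  obtain ⟨C₀, hC₀, hθ⟩ := exists_theta_sub_le hA
  obtain ⟨C₁, hC₁, h₁⟩ := exists_rpow_div_log_rpow_le (show 0 < c + 1 by linarith) hA
  have hb : 0 < (c + 1) / 2 := by linarith
  obtain ⟨C₂, hC₂, h₂⟩ := exists_rpow_div_log_rpow_le hb hA
  set b := (c + 1) / 2 with hbdef
  set l := Real.log (3 / 2) with hldef
  have hl : 0 < l := Real.log_pos (by norm_num)
  set D : ℝ := 1 / l + 1 / l ^ 2 with hD
  have hD0 : 0 < D := by positivity
  refine ⟨K / l * C₀ * C₁ + K / l * C₀ * C₁ + K * D * C₀ * C₂ / b, fun y x hy hyx ↦ ?_⟩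
  set g : ℝ → ℝ := fun t ↦ f t / Real.log t with hgdef
  have hlog : ∀ t : ℝ, 3 / 2 ≤ t → l ≤ Real.log t := fun t ht ↦
    Real.log_le_log (by norm_num) ht
  have hderiv : ∀ t : ℝ, 3 / 2 ≤ t → HasDerivAt g
      ((deriv f t * Real.log t - f t * t⁻¹) / Real.log t ^ 2) t := fun t ht ↦
    (hdiff t (by linarith)).hasDerivAt.div (Real.hasDerivAt_log (by linarith))
      (hl.trans_le (hlog t ht)).ne'
  have hgbound : ∀ t : ℝ, 3 / 2 ≤ t → |g t| ≤ K / l * t ^ c := by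
    intro t ht
    have h0 := hl.trans_le (hlog t ht)
    rw [hgdef]
    simp only
    rw [abs_div, abs_of_pos h0]
    calc |f t| / Real.log t ≤ K * t ^ c / l :=
          div_le_div₀ (by have := Real.rpow_nonneg (by linarith : 0 ≤ t) c; positivity)
            (hf t (by linarith)) hl (hlog t ht)
      _ = _ := by ring
  have hg'bound : ∀ t : ℝ, 3 / 2 ≤ t → |deriv g t| ≤ K * D * t ^ (c - 1) := by
    intro t ht
    have ht0 : 0 < t := by linarith
    have h0 := hl.trans_le (hlog t ht)
    have e : (deriv f t * Real.log t - f t * t⁻¹) / Real.log t ^ 2 =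
        deriv f t / Real.log t - f t * t⁻¹ / Real.log t ^ 2 := by
      field_simp
    rw [(hderiv t ht).deriv, e]
    refine (abs_sub _ _).trans ?_
    rw [abs_div, abs_div, abs_mul, abs_of_pos h0, abs_of_pos (inv_pos.2 ht0),
      abs_of_pos (pow_pos h0 2)]
    have h3 : K * t ^ c * t⁻¹ = K * t ^ (c - 1) := by
      rw [Real.rpow_sub_one ht0.ne']; ring
    calc |deriv f t| / Real.log t + |f t| * t⁻¹ / Real.log t ^ 2
        ≤ K * t ^ (c - 1) / l + K * t ^ c * t⁻¹ / l ^ 2 := by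
          refine add_le_add ?_ ?_
          · exact div_le_div₀ (by positivity) (hf' t (by linarith)) hl (hlog t ht)
          · refine div_le_div₀ (by positivity) ?_ (by positivity)
              (pow_le_pow_left₀ hl.le (hlog t ht) 2)
            exact mul_le_mul_of_nonneg_right (hf t (by linarith)) (by positivity)
      _ = _ := by rw [h3, hD]; ring
  have hpowcont : ∀ r : ℝ, ContinuousOn (fun t : ℝ ↦ t ^ r) (Set.Icc y x) := fun r t ht ↦
    (Real.continuousAt_rpow_const t r (Or.inl (by linarith [ht.1]))).continuousWithinAt
  have hg'int : MeasureTheory.IntegrableOn (deriv g) (Set.Icc y x) := by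
    refine ((hpowcont (c - 1)).integrableOn_Icc.const_mul (K * D)).mono'
      (measurable_deriv g).aestronglyMeasurable ?_
    rw [MeasureTheory.ae_restrict_iff' measurableSet_Icc]
    exact Eventually.of_forall fun t ht ↦ hg'bound t (by linarith [ht.1])
  have hid := sum_primes_eq_integral_theta (by linarith) hyx
    (fun t ht ↦ (hderiv t (by linarith [ht.1])).differentiableAt) hg'int
  have hsum : ∑ p ∈ (Finset.Icc 2 ⌊x⌋₊).filter (fun p : ℕ => p.Prime ∧ y < (p : ℝ)), f (p : ℝ) =
      ∑ p ∈ (Icc 2 ⌊x⌋₊).filter (fun p : ℕ ↦ p.Prime ∧ y < (p : ℝ)), g p * Real.log p := by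
    refine sum_congr rfl fun p hp ↦ ?_
    have hp2 : (3 / 2 : ℝ) ≤ p := hy.le.trans (mem_filter.1 hp).2.2.le
    exact (div_mul_cancel₀ _ (hl.trans_le (hlog p hp2)).ne').symm
  rw [hsum, hid]
  set E := x ^ (c + 1) / Real.log x ^ A with hE
  have hgθ : ∀ t : ℝ, 3 / 2 ≤ t → t ≤ x →
      |g t * (Chebyshev.theta t - t)| ≤ K / l * C₀ * C₁ * E := by
    intro t ht htx
    have ht0 : 0 < t := by linarith
    have h0 := hl.trans_le (hlog t ht)
    rw [abs_mul]
    calc |g t| * |Chebyshev.theta t - t| ≤ K / l * t ^ c * (C₀ * (t / Real.log t ^ A)) :=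
          mul_le_mul (hgbound t ht) (hθ t ht) (abs_nonneg _) (by positivity)
      _ = K / l * C₀ * (t ^ (c + 1) / Real.log t ^ A) := by
          rw [Real.rpow_add_one ht0.ne']; ring
      _ ≤ K / l * C₀ * (C₁ * E) := by gcongr; exact h₁ t x ht htx
      _ = _ := by ring
  have hlx : 0 < Real.log x := hl.trans_le (hlog x (by linarith))
  have hx0 : 0 < x := by linarith
  have hintegθ : |∫ t in y..x, deriv g t * (Chebyshev.theta t - t)| ≤ K * D * C₀ * C₂ / b * E := by
    have hpt : ∀ t ∈ Set.Ioc y x, ‖deriv g t * (Chebyshev.theta t - t)‖ ≤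
        K * D * C₀ * (C₂ * (x ^ b / Real.log x ^ A)) * t ^ (b - 1) := by
      intro t ht
      have ht32 : 3 / 2 ≤ t := by linarith [ht.1]
      have ht0 : 0 < t := by linarith
      have h0 := hl.trans_le (hlog t ht32)
      rw [Real.norm_eq_abs, abs_mul]
      have e : t ^ (c - 1) * t = t ^ b * t ^ (b - 1) := by
        rw [← Real.rpow_add_one ht0.ne', ← Real.rpow_add ht0]
        congr 1
        rw [hbdef]; ring
      calc |deriv g t| * |Chebyshev.theta t - t|
          ≤ K * D * t ^ (c - 1) * (C₀ * (t / Real.log t ^ A)) :=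
            mul_le_mul (hg'bound t ht32) (hθ t ht32) (abs_nonneg _) (by positivity)
        _ = K * D * C₀ * (t ^ (c - 1) * t / Real.log t ^ A) := by ring
        _ = K * D * C₀ * (t ^ b / Real.log t ^ A) * t ^ (b - 1) := by rw [e]; ring
        _ ≤ _ := by gcongr; exact h₂ t x ht32 ht.2
    have hnorm := intervalIntegral.norm_integral_le_of_norm_le hyx (Eventually.of_forall hpt)
      (((hpowcont (b - 1)).intervalIntegrable_of_Icc (μ := MeasureTheory.volume) hyx).const_mul _)
    rw [Real.norm_eq_abs, intervalIntegral.integral_const_mul,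
      integral_rpow (Or.inl (by linarith)), sub_add_cancel] at hnorm
    have hy0 : 0 < y := by linarith
    calc _ ≤ K * D * C₀ * (C₂ * (x ^ b / Real.log x ^ A)) * (x ^ b / b) := by
          refine hnorm.trans ?_
          gcongr
          have : 0 ≤ y ^ b := by positivity
          linarith
      _ = K * D * C₀ * C₂ / b * (x ^ b * x ^ b / Real.log x ^ A) := by ring
      _ = _ := by
          rw [← Real.rpow_add hx0, show b + b = c + 1 by rw [hbdef]; ring]
  have hgx := hgθ x (by linarith) le_rfl
  have hgy := hgθ y hy.le hyx
  calc _ ≤ |g x * (Chebyshev.theta x - x)| + |g y * (Chebyshev.theta y - y)| +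
        |∫ t in y..x, deriv g t * (Chebyshev.theta t - t)| :=
        (abs_sub _ _).trans (by gcongr; exact abs_sub _ _)
    _ ≤ _ := by linarith
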